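/- arXiv:2401.12411 — 11 statements merged into one kernel-verified Lean document; each statement's English description precedes it below -/
import Mathlib

section
/- Every heteroclinic solution z satisfies ζ_l < e^{z(ξ)} < (K₁/ζ_l)² for all ξ ∈ ℝ. -/
/-- Every heteroclinic solution `z` satisfies `ζ_l < e^{z(ξ)} < (K₁/ζ_l)²` for all `ξ`. -/
theorem stmt_3 (ζl wl s c : ℝ) (hζl : 0 < ζl)
    (hlax : s > wl / ζl + Real.sqrt ζl) (hc : 0 < c)
    (K1 K2 : ℝ) (hK1 : K1 = wl - s * ζl)
    (hK2 : K2 = -s * wl + ζl ^ 2 / 2 + wl ^ 2 / ζl)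
    (F : ℝ → ℝ) (hF : ∀ ζ, F ζ = ζ / 2 + K1 ^ 2 / ζ ^ 2 - (K2 - s * K1) / ζ)
    (ζr : ℝ) (hζr : ζr = -ζl / 2 + (1 / 2) * Real.sqrt ((8 * K1 ^ 2 + ζl ^ 3) / ζl))
    (zl zr : ℝ) (hzl : zl = Real.log ζl) (hzr : zr = Real.log ζr)
    (z : ℝ → ℝ) (hz : ContDiff ℝ 2 z)
    (hnc : ∃ a b, z a ≠ z b)
    (hode : ∀ ξ, (K1 ^ 2 / 3) * deriv (deriv z) ξ + c * deriv z ξ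
      + F (Real.exp (z ξ)) = 0)
    (hlim1 : Filter.Tendsto z Filter.atBot (nhds zl))
    (hlim2 : Filter.Tendsto z Filter.atTop (nhds zr))
    (hlim3 : Filter.Tendsto (deriv z) Filter.atBot (nhds 0))
    (hlim4 : Filter.Tendsto (deriv z) Filter.atTop (nhds 0)) :
    ∀ ξ : ℝ, ζl < Real.exp (z ξ) ∧ Real.exp (z ξ) < (K1 / ζl) ^ 2 := by
  have hsq : Real.sqrt ζl ^ 2 = ζl := Real.sq_sqrt hζl.le
  have hsp : 0 < Real.sqrt ζl := Real.sqrt_pos.2 hζl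
  have hKneg : ζl * Real.sqrt ζl < -K1 := by
    have h1 : wl / ζl < s - Real.sqrt ζl := by linarith
    rw [div_lt_iff₀ hζl] at h1
    rw [hK1]; linarith
  have hK3 : ζl ^ 3 < K1 ^ 2 := by
    have h0 : 0 < ζl * Real.sqrt ζl := by positivity
    have h2 : (ζl * Real.sqrt ζl) ^ 2 < (-K1) ^ 2 := by gcongr
    have h3 : (ζl * Real.sqrt ζl) ^ 2 = ζl ^ 3 := by rw [mul_pow, hsq]; ring
    rw [h3] at h2; simpa using h2
  have hK0 : 0 < K1 ^ 2 := lt_trans (by positivity) hK3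
  have hB : K2 - s * K1 = ζl ^ 2 / 2 + K1 ^ 2 / ζl := by
    rw [hK2, hK1]; field_simp; ring
  have hrl : ζl < ζr := by
    have : 3 * ζl < Real.sqrt ((8 * K1 ^ 2 + ζl ^ 3) / ζl) := by
      apply Real.lt_sqrt_of_sq_lt
      rw [lt_div_iff₀ hζl]; nlinarith
    rw [hζr]; linarith
  have hzlr : zl < zr := by
    rw [hzl, hzr]; exact Real.log_lt_log hζl hrl
  have hezl : Real.exp zl = ζl := by rw [hzl, Real.exp_log hζl]
  have hd1 : ∀ x, HasDerivAt z (deriv z x) x := fun x =>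
    ((hz.differentiable (by norm_num)) x).hasDerivAt
  have hz' : ContDiff ℝ 1 (deriv z) := by
    have : ContDiff ℝ (1 + 1) z := by simpa [one_add_one_eq_two] using hz
    exact (contDiff_succ_iff_deriv.1 this).2.2
  have hd2 : ∀ x, HasDerivAt (deriv z) (deriv (deriv z) x) x := fun x =>
    ((hz'.differentiable (by norm_num)) x).hasDerivAt
  set B : ℝ := ζl ^ 2 / 2 + K1 ^ 2 / ζl with hBdef
  obtain ⟨G, hG⟩ : ∃ G : ℝ → ℝ, G = fun y => Real.exp y / 2
    - K1 ^ 2 / 2 * Real.exp (-y) ^ 2 + B * Real.exp (-y) := ⟨_, rfl⟩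
  obtain ⟨E, hE⟩ : ∃ E : ℝ → ℝ, E = fun x => K1 ^ 2 / 6 * deriv z x ^ 2 + G (z x) := ⟨_, rfl⟩
  have hGc : Continuous G := by rw [hG]; fun_prop
  have hGd : ∀ y, HasDerivAt G (F (Real.exp y)) y := by
    intro y
    have e1 := Real.hasDerivAt_exp y
    have e2 := (hasDerivAt_neg y).exp
    have e3 := ((e1.div_const 2).sub ((e2.pow 2).const_mul (K1 ^ 2 / 2))).add (e2.const_mul B)
    rw [hG]
    refine e3.congr_deriv ?_
    rw [hF, hB, Real.exp_neg]
    have := Real.exp_pos y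
    norm_num
    field_simp
    ring
  have hEd : ∀ x, HasDerivAt E (-c * deriv z x ^ 2) x := by
    intro x
    have e := (((hd2 x).pow 2).const_mul (K1 ^ 2 / 6)).add ((hGd (z x)).comp x (hd1 x))
    rw [hE]
    refine e.congr_deriv ?_
    have := hode x
    norm_num
    linear_combination (deriv z x) * this
  have hanti : Antitone E := by
    apply antitone_of_deriv_nonpos (fun x => (hEd x).differentiableAt)
    intro x
    rw [(hEd x).deriv]
    nlinarith [sq_nonneg (deriv z x)]
  have hElim : Filter.Tendsto E Filter.atBot (nhds (G zl)) := by
    have := ((hlim3.pow 2).const_mul (K1 ^ 2 / 6)).add ((hGc.tendsto zl).comp hlim1)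
    rw [hE]
    simpa using this
  have hEle : ∀ x, E x ≤ G zl := fun x => hanti.ge_of_tendsto hElim x
  have hGdiff : ∀ y, G y - G zl = (Real.exp y - ζl) ^ 2 / (2 * Real.exp y)
      * (1 - K1 ^ 2 / (Real.exp y * ζl ^ 2)) := by
    intro y
    have := Real.exp_pos y
    simp only [hG, Real.exp_neg, hezl, hBdef]
    field_simp
    ring
  have hmain : ∀ x, K1 ^ 2 / 6 * deriv z x ^ 2 + (Real.exp (z x) - ζl) ^ 2 / (2 * Real.exp (z x))
      * (1 - K1 ^ 2 / (Real.exp (z x) * ζl ^ 2)) ≤ 0 := by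
    intro x
    have h := hEle x
    rw [hE] at h
    rw [← hGdiff]
    dsimp only at h
    linarith
  have hed : ∀ x, HasDerivAt (fun x => Real.exp (z x) - ζl) (Real.exp (z x) * deriv z x) x :=
    fun x => ((hd1 x).exp).sub_const ζl
  have hbound : ∀ x, ‖Real.exp (z x) * deriv z x‖ ≤ (2 / ζl) * ‖Real.exp (z x) - ζl‖ := by
    intro x
    have h := hmain x
    have hp := Real.exp_pos (z x)
    generalize Real.exp (z x) = u at *
    generalize deriv z x = p at *
    rw [Real.norm_eq_abs, Real.norm_eq_abs, ← abs_of_pos (show 0 < 2 / ζl by positivity), ← abs_mul]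
    apply sq_le_sq.1
    have e : K1 ^ 2 / 6 * p ^ 2 + (u - ζl) ^ 2 / (2 * u) * (1 - K1 ^ 2 / (u * ζl ^ 2))
      = K1 ^ 2 / (6 * u ^ 2) * ((u * p) ^ 2 - 3 / 4 * (2 / ζl * (u - ζl)) ^ 2)
        + (u - ζl) ^ 2 / (2 * u) := by
      field_simp
      ring
    rw [e] at h
    have h1 : 0 ≤ (u - ζl) ^ 2 / (2 * u) := by positivity
    have h2 : 0 < K1 ^ 2 / (6 * u ^ 2) := by positivity
    have h3 : (u * p) ^ 2 - 3 / 4 * (2 / ζl * (u - ζl)) ^ 2 ≤ 0 := by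
      by_contra hcon
      push Not at hcon
      have := mul_pos h2 hcon
      linarith
    nlinarith [sq_nonneg (2 / ζl * (u - ζl))]
  have hne : ∀ x, z x ≠ zl := by
    intro a ha
    have hall : ∀ x ≥ a, z x = zl := by
      intro b hb
      have := eq_zero_of_abs_deriv_le_mul_abs_self_of_eq_zero_right
        (f := fun x => Real.exp (z x) - ζl) (f' := fun x => Real.exp (z x) * deriv z x)
        (K := 2 / ζl) (a := a) (b := b)
        (fun x _ => (hed x).continuousAt.continuousWithinAt)
        (fun x _ => (hed x).hasDerivWithinAt) (by simp [ha, hezl]) (fun x _ => hbound x)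
        b ⟨hb, le_rfl⟩
      apply Real.exp_injective
      rw [hezl]
      simpa [sub_eq_zero] using this
    have h1 : Filter.Tendsto z Filter.atTop (nhds zl) := by
      refine tendsto_const_nhds.congr' ?_
      filter_upwards [Filter.eventually_ge_atTop a] with x hx using (hall x hx).symm
    exact hzlr.ne (tendsto_nhds_unique h1 hlim2)
  have hgt : ∀ x, zl < z x := by
    intro x
    by_contra hcon
    push Not at hcon
    obtain ⟨b, hb, hxb⟩ := ((hlim2.eventually (lt_mem_nhds hzlr)).and
      (Filter.eventually_ge_atTop x)).exists
    obtain ⟨y, _, hy⟩ := intermediate_value_Icc hxb hz.continuous.continuousOn ⟨hcon, hb.le⟩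
    exact hne y hy
  have hgt' : ∀ x, ζl < Real.exp (z x) := fun x => by
    rw [← hezl]; exact Real.exp_lt_exp.2 (hgt x)
  intro ξ
  refine ⟨hgt' ξ, ?_⟩
  by_contra hcon
  push Not at hcon
  have hu := Real.exp_pos (z ξ)
  have hEeq : G zl ≤ E ξ := by
    have h1 : K1 ^ 2 / (Real.exp (z ξ) * ζl ^ 2) ≤ 1 := by
      rw [div_pow, div_le_iff₀ (by positivity)] at hcon
      rw [div_le_one (by positivity)]
      exact hcon
    have h2 := hGdiff (z ξ)
    have h3 : 0 ≤ (Real.exp (z ξ) - ζl) ^ 2 / (2 * Real.exp (z ξ))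
      * (1 - K1 ^ 2 / (Real.exp (z ξ) * ζl ^ 2)) :=
      mul_nonneg (by positivity) (by linarith)
    have h4 : 0 ≤ K1 ^ 2 / 6 * deriv z ξ ^ 2 := by positivity
    rw [hE]
    dsimp only
    linarith
  have hconst : ∀ x ≤ ξ, E x = G zl := fun x hx =>
    le_antisymm (hEle x) (hEeq.trans (hanti hx))
  have hder0 : ∀ x < ξ, deriv z x = 0 := by
    intro x hx
    have h1 : E =ᶠ[nhds x] fun _ => G zl := by
      filter_upwards [Iio_mem_nhds hx] with y hy using hconst y (le_of_lt hy)
    have h2 := (hEd x).unique ((hasDerivAt_const x (G zl)).congr_of_eventuallyEq h1)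
    have h3 : deriv z x ^ 2 = 0 := by
      rcases mul_eq_zero.1 h2 with h | h
      · linarith
      · exact h
    exact pow_eq_zero_iff (by norm_num) |>.1 h3
  have hzc : ∀ x ≤ ξ, z ξ = z x := by
    intro x hx
    refine constant_of_has_deriv_right_zero hz.continuous.continuousOn ?_ ξ ⟨hx, le_rfl⟩
    intro y hy
    rw [← hder0 y hy.2]
    exact (hd1 y).hasDerivWithinAt
  have h1 : Filter.Tendsto z Filter.atBot (nhds (z ξ)) := by
    refine tendsto_const_nhds.congr' ?_
    filter_upwards [Filter.eventually_le_atBot ξ] with x hx using hzc x hx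
  exact hne ξ (tendsto_nhds_unique h1 hlim1)
end

section
/- Let z be a heteroclinic solution and write ζ(ξ) = e^{z(ξ)}. If x₀ ∈ ℝ satisfies z'(x₀) = 0, then x₀ is an isolated critical point of z and a strict local extremum; moreover, if ζ(x₀) > ζ_r then x₀ is a strict local maximum of z, while if ζ_l < ζ(x₀) < ζ_r then x₀ is a strict local minimum of z. -/
lemma aux_min (z : ℝ → ℝ) (x₀ : ℝ) (h0 : deriv z x₀ = 0) (h2 : 0 < deriv (deriv z) x₀)
    (hc : Continuous z) :
    ∃ δ > (0:ℝ), ∀ x, x ≠ x₀ → |x - x₀| < δ → deriv z x ≠ 0 ∧ z x₀ < z x := by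
  have hmin := isLocalMin_of_deriv_deriv_pos h2 h0 hc.continuousAt
  have hd : DifferentiableAt ℝ (deriv z) x₀ := by
    by_contra h
    rw [deriv_zero_of_not_differentiableAt h] at h2
    exact lt_irrefl _ h2
  have hne := hd.hasDerivAt.eventually_ne (c := 0) h2.ne'
  rw [eventually_nhdsWithin_iff] at hne
  obtain ⟨δ, hδ, H⟩ := Metric.eventually_nhds_iff.1 (hne.and hmin)
  refine ⟨δ, hδ, fun x hx hxd => ?_⟩
  have hx1 := H (y := x) (by rwa [Real.dist_eq])
  have h1 := hx1.1 hx
  refine ⟨h1, lt_of_le_of_ne hx1.2 fun heq => h1 ?_⟩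
  apply IsLocalMin.deriv_eq_zero
  have hb : Metric.ball x₀ δ ∈ nhds x :=
    Metric.isOpen_ball.mem_nhds (by rwa [Metric.mem_ball, Real.dist_eq])
  filter_upwards [hb] with y hy
  rw [← heq]
  exact (H hy).2

lemma aux_max (z : ℝ → ℝ) (x₀ : ℝ) (h0 : deriv z x₀ = 0) (h2 : deriv (deriv z) x₀ < 0)
    (hc : Continuous z) :
    ∃ δ > (0:ℝ), ∀ x, x ≠ x₀ → |x - x₀| < δ → deriv z x ≠ 0 ∧ z x < z x₀ := by
  have e : deriv (-z) = -deriv z := by ext x; simp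
  have e2 : deriv (-deriv z) = -deriv (deriv z) := by ext x; simp
  obtain ⟨δ, hδ, H⟩ := aux_min (-z) x₀ (by rw [e]; simpa using h0)
    (by rw [e, e2]; simpa using h2) hc.neg
  refine ⟨δ, hδ, fun x hx hxd => ?_⟩
  have := H x hx hxd
  rw [e] at this
  simpa using this

lemma aux_unique (g : ℝ → ℝ) (hg : ContDiff ℝ 1 g) (k : ℝ) (z : ℝ → ℝ) (hz : ContDiff ℝ 2 z)
    (h : ∀ ξ, deriv (deriv z) ξ = -k * deriv z ξ - g (z ξ)) (x₀ : ℝ)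
    (h0 : deriv z x₀ = 0) (hg0 : g (z x₀) = 0) (x : ℝ) : z x = z x₀ := by
  have hz1 : ContDiff ℝ 1 (deriv z) := by
    have : ContDiff ℝ (1 + 1) z := by simpa [one_add_one_eq_two] using hz
    exact (contDiff_succ_iff_deriv.1 this).2.2
  have hzd : ∀ t, HasDerivAt z (deriv z t) t := fun t =>
    (hz.differentiable (by norm_num) t).hasDerivAt
  have hzd1 : ∀ t, HasDerivAt (deriv z) (deriv (deriv z) t) t := fun t =>
    (hz1.differentiable (by norm_num) t).hasDerivAt
  let v : ℝ × ℝ → ℝ × ℝ := fun p => (p.2, -k * p.2 - g p.1)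
  have hv : ContDiff ℝ 1 v := by fun_prop
  let f : ℝ → ℝ × ℝ := fun t => (z t, deriv z t)
  have hf : ∀ t, HasDerivAt f (v (f t)) t := by
    intro t
    have := (hzd t).prodMk (hzd1 t)
    rw [h t] at this
    exact this
  have hfc : Continuous f := continuous_iff_continuousAt.2 fun t => (hf t).continuousAt
  set R := |x - x₀| + 1 with hR
  have hRp : 0 < R := by positivity
  let S : Set (ℝ × ℝ) := f '' Set.Icc (x₀ - R) (x₀ + R)
  have hS : IsCompact S := isCompact_Icc.image hfc
  obtain ⟨K, hK⟩ := hv.locallyLipschitz.locallyLipschitzOn.exists_lipschitzOnWith_of_compact hS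
  have hx0 : f x₀ ∈ S := ⟨x₀, ⟨by linarith, by linarith⟩, rfl⟩
  have hv0 : v (f x₀) = 0 := by
    simp [v, f, h0, hg0]
  have key := ODE_solution_unique_of_mem_Icc (v := fun _ => v) (s := fun _ => S) (K := K)
    (f := f) (g := fun _ => f x₀) (a := x₀ - R) (b := x₀ + R) (t₀ := x₀)
    (fun _ _ => hK) ⟨by linarith, by linarith⟩ hfc.continuousOn (fun t _ => hf t)
    (fun t ht => ⟨t, Set.Ioo_subset_Icc_self ht, rfl⟩) continuousOn_const
    (fun t _ => by simpa [hv0] using hasDerivAt_const t (f x₀)) (fun _ _ => hx0) rfl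
  have hxm : x ∈ Set.Icc (x₀ - R) (x₀ + R) := by
    have := abs_le.1 (le_refl |x - x₀|)
    constructor <;> linarith [this.1, this.2]
  exact congrArg Prod.fst (key hxm)


/-- For a heteroclinic solution `z` with `ζ(ξ) = e^{z(ξ)}`: any critical point `x₀`
of `z` is isolated and a strict local extremum; it is a strict local maximum when
`ζ(x₀) > ζ_r` and a strict local minimum when `ζ_l < ζ(x₀) < ζ_r`. -/
theorem stmt_4 (ζl wl s c : ℝ) (hζl : 0 < ζl)
    (hlax : s > wl / ζl + Real.sqrt ζl) (hc : 0 < c)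
    (K1 K2 : ℝ) (hK1 : K1 = wl - s * ζl)
    (hK2 : K2 = -s * wl + ζl ^ 2 / 2 + wl ^ 2 / ζl)
    (F : ℝ → ℝ) (hF : ∀ ζ, F ζ = ζ / 2 + K1 ^ 2 / ζ ^ 2 - (K2 - s * K1) / ζ)
    (ζr : ℝ) (hζr : ζr = -ζl / 2 + (1 / 2) * Real.sqrt ((8 * K1 ^ 2 + ζl ^ 3) / ζl))
    (zl zr : ℝ) (hzl : zl = Real.log ζl) (hzr : zr = Real.log ζr)
    (z : ℝ → ℝ) (hz : ContDiff ℝ 2 z)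
    (hnc : ∃ a b, z a ≠ z b)
    (hode : ∀ ξ, (K1 ^ 2 / 3) * deriv (deriv z) ξ + c * deriv z ξ
      + F (Real.exp (z ξ)) = 0)
    (hlim1 : Filter.Tendsto z Filter.atBot (nhds zl))
    (hlim2 : Filter.Tendsto z Filter.atTop (nhds zr))
    (hlim3 : Filter.Tendsto (deriv z) Filter.atBot (nhds 0))
    (hlim4 : Filter.Tendsto (deriv z) Filter.atTop (nhds 0))
    (x₀ : ℝ) (hx₀ : deriv z x₀ = 0) :
    (∃ δ > (0:ℝ), ∀ x, x ≠ x₀ → |x - x₀| < δ → deriv z x ≠ 0) ∧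
    ((∃ δ > (0:ℝ), ∀ x, x ≠ x₀ → |x - x₀| < δ → z x < z x₀) ∨
     (∃ δ > (0:ℝ), ∀ x, x ≠ x₀ → |x - x₀| < δ → z x₀ < z x)) ∧
    (ζr < Real.exp (z x₀) →
      ∃ δ > (0:ℝ), ∀ x, x ≠ x₀ → |x - x₀| < δ → z x < z x₀) ∧
    (ζl < Real.exp (z x₀) → Real.exp (z x₀) < ζr →
      ∃ δ > (0:ℝ), ∀ x, x ≠ x₀ → |x - x₀| < δ → z x₀ < z x) := by
  have hK1neg : K1 < 0 ∧ ζl ^ 3 < K1 ^ 2 := by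
    have h1 : wl + Real.sqrt ζl * ζl < s * ζl := by
      have := mul_lt_mul_of_pos_right hlax hζl
      rwa [add_mul, div_mul_cancel₀ _ hζl.ne'] at this
    have h2 : 0 < Real.sqrt ζl * ζl := by positivity
    have h3 : Real.sqrt ζl * ζl < -K1 := by rw [hK1]; linarith
    refine ⟨by linarith, ?_⟩
    have h4 : (Real.sqrt ζl * ζl) ^ 2 = ζl ^ 3 := by
      rw [mul_pow, Real.sq_sqrt hζl.le]; ring
    nlinarith
  obtain ⟨hneg, hK3⟩ := hK1neg
  have hK0 : K1 ≠ 0 := hneg.ne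
  have hKp : 0 < K1 ^ 2 := by positivity
  set q := Real.sqrt ((8 * K1 ^ 2 + ζl ^ 3) / ζl) with hq
  have hqn : 0 ≤ q := Real.sqrt_nonneg _
  have hqs : q ^ 2 * ζl = 8 * K1 ^ 2 + ζl ^ 3 := by
    rw [hq, Real.sq_sqrt (by positivity)]; field_simp
  have hrl : ζl < ζr := by
    have : 3 * ζl < q := by
      by_contra hcon
      push Not at hcon
      have : q ^ 2 ≤ (3 * ζl) ^ 2 := by gcongr
      nlinarith
    rw [hζr]; linarith
  have hrq : ζl * ζr * (ζr + ζl) = 2 * K1 ^ 2 := by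
    rw [hζr]; nlinarith
  have hA : K2 - s * K1 = ζl ^ 2 / 2 + K1 ^ 2 / ζl := by
    rw [hK2, hK1]; field_simp; ring
  have hFf : ∀ y, 0 < y → F y = (y - ζl) * (y - ζr) * (y + ζr + ζl) / (2 * y ^ 2) := by
    intro y hy
    rw [hF, hA]
    have : K1 ^ 2 = ζl * ζr * (ζr + ζl) / 2 := by linarith
    rw [this]; field_simp; ring
  have hcz : Continuous z := hz.continuous
  have hcrit : deriv (deriv z) x₀ = -(3 / K1 ^ 2) * F (Real.exp (z x₀)) := by
    have := hode x₀
    rw [hx₀] at this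
    field_simp
    linarith
  have hcoef : 0 < 3 / K1 ^ 2 := by positivity
  have hep := Real.exp_pos (z x₀)
  have hFne : F (Real.exp (z x₀)) ≠ 0 := by
    intro h0
    obtain ⟨a, b, hab⟩ := hnc
    have hg : ContDiff ℝ 1 (fun u : ℝ => 3 / K1 ^ 2 * F (Real.exp u)) := by
      have : F = fun ζ => ζ / 2 + K1 ^ 2 / ζ ^ 2 - (K2 - s * K1) / ζ := funext hF
      rw [this]
      refine contDiff_const.mul (((Real.contDiff_exp.div_const _).add
        (contDiff_const.div (Real.contDiff_exp.pow 2) fun u => by positivity)).sub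
        (contDiff_const.div Real.contDiff_exp fun u => by positivity))
    have hu := aux_unique _ hg (3 * c / K1 ^ 2) z hz (fun ξ => by
      have := hode ξ
      field_simp
      linarith) x₀ hx₀ (by simp [h0])
    exact hab ((hu a).trans (hu b).symm)
  have hmax : 0 < F (Real.exp (z x₀)) →
      ∃ δ > (0:ℝ), ∀ x, x ≠ x₀ → |x - x₀| < δ → deriv z x ≠ 0 ∧ z x < z x₀ := fun h =>
    aux_max z x₀ hx₀ (by rw [hcrit]; nlinarith [mul_pos hcoef h]) hcz
  have hmin : F (Real.exp (z x₀)) < 0 →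
      ∃ δ > (0:ℝ), ∀ x, x ≠ x₀ → |x - x₀| < δ → deriv z x ≠ 0 ∧ z x₀ < z x := fun h =>
    aux_min z x₀ hx₀ (by rw [hcrit]; nlinarith [mul_pos hcoef (neg_pos.2 h)]) hcz
  refine ⟨?_, ?_, fun h => ?_, fun h1 h2 => ?_⟩
  · rcases lt_or_gt_of_ne hFne with h | h
    · obtain ⟨δ, hδ, H⟩ := hmin h
      exact ⟨δ, hδ, fun x a b => (H x a b).1⟩
    · obtain ⟨δ, hδ, H⟩ := hmax h
      exact ⟨δ, hδ, fun x a b => (H x a b).1⟩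
  · rcases lt_or_gt_of_ne hFne with h | h
    · obtain ⟨δ, hδ, H⟩ := hmin h
      exact Or.inr ⟨δ, hδ, fun x a b => (H x a b).2⟩
    · obtain ⟨δ, hδ, H⟩ := hmax h
      exact Or.inl ⟨δ, hδ, fun x a b => (H x a b).2⟩
  · obtain ⟨δ, hδ, H⟩ := hmax (by
      rw [hFf _ hep]
      exact div_pos (mul_pos (mul_pos (by linarith) (by linarith)) (by linarith)) (by positivity))
    exact ⟨δ, hδ, fun x a b => (H x a b).2⟩
  · obtain ⟨δ, hδ, H⟩ := hmin (by
      rw [hFf _ hep]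
      exact div_neg_of_neg_of_pos (mul_neg_of_neg_of_pos
        (mul_neg_of_pos_of_neg (by linarith) (by linarith)) (by linarith)) (by positivity))
    exact ⟨δ, hδ, fun x a b => (H x a b).2⟩
end

section
/- Under the Lax condition, the derivative of F satisfies F'(ζ_l) = (ζ_l³ − K₁²)/ζ_l³ and F'(ζ_r) = (ζ_r³ − K₁²)/ζ_r³; moreover ζ_l³ < K₁² < ζ_r³, so that F'(ζ_l) < 0 and F'(ζ_r) > 0. -/
/-- Under the Lax condition, `F'(ζ_l) = (ζ_l³ − K₁²)/ζ_l³` and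
`F'(ζ_r) = (ζ_r³ − K₁²)/ζ_r³`; moreover `ζ_l³ < K₁² < ζ_r³`, so that
`F'(ζ_l) < 0` and `F'(ζ_r) > 0`. -/
theorem stmt_7 (ζl wl s : ℝ) (hζl : 0 < ζl)
    (hlax : s > wl / ζl + Real.sqrt ζl)
    (K1 K2 : ℝ) (hK1 : K1 = wl - s * ζl)
    (hK2 : K2 = -s * wl + ζl ^ 2 / 2 + wl ^ 2 / ζl)
    (F : ℝ → ℝ) (hF : ∀ ζ, F ζ = ζ / 2 + K1 ^ 2 / ζ ^ 2 - (K2 - s * K1) / ζ)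
    (ζr : ℝ) (hζr : ζr = -ζl / 2 + (1 / 2) * Real.sqrt ((8 * K1 ^ 2 + ζl ^ 3) / ζl)) :
    deriv F ζl = (ζl ^ 3 - K1 ^ 2) / ζl ^ 3 ∧
    deriv F ζr = (ζr ^ 3 - K1 ^ 2) / ζr ^ 3 ∧
    ζl ^ 3 < K1 ^ 2 ∧ K1 ^ 2 < ζr ^ 3 ∧
    deriv F ζl < 0 ∧ 0 < deriv F ζr := by
  have hC : K2 - s * K1 = ζl ^ 2 / 2 + K1 ^ 2 / ζl := by
    rw [hK2, hK1]; field_simp; ring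
  have hd : ∀ x : ℝ, x ≠ 0 →
      deriv F x = 1 / 2 - 2 * K1 ^ 2 / x ^ 3 + (K2 - s * K1) / x ^ 2 := by
    intro x hx
    have hFe : F = fun ζ => ζ / 2 + K1 ^ 2 / ζ ^ 2 - (K2 - s * K1) / ζ := funext hF
    have h1 : HasDerivAt (fun ζ : ℝ => ζ / 2) (1 / 2) x := (hasDerivAt_id x).div_const 2
    have h2 := (hasDerivAt_const x (K1 ^ 2)).fun_div (hasDerivAt_pow 2 x) (pow_ne_zero 2 hx)
    have h3 := (hasDerivAt_const x (K2 - s * K1)).fun_div (hasDerivAt_id' x) hx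
    have h4 := ((h1.fun_add h2).fun_sub h3).deriv
    rw [hFe, h4]
    generalize K2 - s * K1 = C
    field_simp
    push_cast
    ring
  have hlt : ζl ^ 3 < K1 ^ 2 := by
    have hq := Real.sq_sqrt hζl.le
    have hq0 := Real.sqrt_nonneg ζl
    have h1 : Real.sqrt ζl < s - wl / ζl := by linarith
    have h2 : Real.sqrt ζl ^ 2 < (s - wl / ζl) ^ 2 := by gcongr
    have h3 : K1 ^ 2 = ζl ^ 2 * (s - wl / ζl) ^ 2 := by
      rw [hK1]; field_simp; ring
    rw [hq] at h2
    rw [h3]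
    calc ζl ^ 3 = ζl ^ 2 * ζl := by ring
      _ < _ := by gcongr
  have hrel : ζl * ζr * (ζl + ζr) = 2 * K1 ^ 2 := by
    have hq : Real.sqrt ((8 * K1 ^ 2 + ζl ^ 3) / ζl) ^ 2 = (8 * K1 ^ 2 + ζl ^ 3) / ζl :=
      Real.sq_sqrt (by positivity)
    have h2 : Real.sqrt ((8 * K1 ^ 2 + ζl ^ 3) / ζl) = 2 * ζr + ζl := by rw [hζr]; ring
    rw [h2, eq_div_iff hζl.ne'] at hq
    linarith
  have hrl : ζl < ζr := by
    have hq : 3 * ζl < Real.sqrt ((8 * K1 ^ 2 + ζl ^ 3) / ζl) := by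
      apply Real.lt_sqrt_of_sq_lt
      rw [lt_div_iff₀ hζl]
      linarith
    linarith
  have hr0 : 0 < ζr := hζl.trans hrl
  have hgt : K1 ^ 2 < ζr ^ 3 := by
    have h1 : ζl * (ζl + ζr) < ζr * (ζr + ζr) := by gcongr
    have h2 := mul_lt_mul_of_pos_left h1 hr0
    linarith
  have hCr : K2 - s * K1 = ζr ^ 2 / 2 + K1 ^ 2 / ζr := by
    have hK : K1 ^ 2 = ζl * ζr * (ζl + ζr) / 2 := by linarith
    rw [hC, hK]; field_simp; ring
  have el : deriv F ζl = (ζl ^ 3 - K1 ^ 2) / ζl ^ 3 := by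
    rw [hd ζl hζl.ne', hC]; field_simp; ring
  have er : deriv F ζr = (ζr ^ 3 - K1 ^ 2) / ζr ^ 3 := by
    rw [hd ζr hr0.ne', hCr]; field_simp; ring
  refine ⟨el, er, hlt, hgt, ?_, ?_⟩
  · rw [el]; exact div_neg_of_neg_of_pos (by linarith) (by positivity)
  · rw [er]; exact div_pos (by linarith) (by positivity)
end

section
/- There exists a unique ζ_c > 0 with F'(ζ_c) = 0; this ζ_c lies in the open interval (ζ_l, ζ_r), F'(ζ) < 0 for all 0 < ζ < ζ_c, and F'(ζ) > 0 for all ζ > ζ_c. Consequently the potential Φ(z) = (3/K₁²)·∫_{ln ζ_l}^{z} F(e^t) dt has exactly one inflection point in the interval (ln ζ_l, ln(K₁²/ζ_l²)), namely z_c = ln ζ_c. -/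
/-- There is a unique `ζ_c > 0` with `F'(ζ_c) = 0`; it lies in `(ζ_l, ζ_r)`,
`F' < 0` on `(0, ζ_c)` and `F' > 0` on `(ζ_c, ∞)`.  Consequently the potential
`Φ(z) = (3/K₁²)∫_{ln ζ_l}^{z} F(eᵗ) dt` has exactly one inflection point in
`(ln ζ_l, ln(K₁²/ζ_l²))`, namely `z_c = ln ζ_c`. -/
theorem stmt_8 (ζl wl s : ℝ) (hζl : 0 < ζl)
    (hlax : s > wl / ζl + Real.sqrt ζl)
    (K1 K2 : ℝ) (hK1 : K1 = wl - s * ζl)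
    (hK2 : K2 = -s * wl + ζl ^ 2 / 2 + wl ^ 2 / ζl)
    (F : ℝ → ℝ) (hF : ∀ ζ, F ζ = ζ / 2 + K1 ^ 2 / ζ ^ 2 - (K2 - s * K1) / ζ)
    (ζr : ℝ) (hζr : ζr = -ζl / 2 + (1 / 2) * Real.sqrt ((8 * K1 ^ 2 + ζl ^ 3) / ζl))
    (Φ : ℝ → ℝ)
    (hΦ : ∀ x, Φ x = (3 / K1 ^ 2) * ∫ t in (Real.log ζl)..x, F (Real.exp t)) :
    ∃ ζc : ℝ, 0 < ζc ∧ deriv F ζc = 0 ∧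
      (∀ ζ', 0 < ζ' → deriv F ζ' = 0 → ζ' = ζc) ∧
      ζl < ζc ∧ ζc < ζr ∧
      (∀ ζ, 0 < ζ → ζ < ζc → deriv F ζ < 0) ∧
      (∀ ζ, ζc < ζ → 0 < deriv F ζ) ∧
      Real.log ζc ∈ Set.Ioo (Real.log ζl) (Real.log (K1 ^ 2 / ζl ^ 2)) ∧
      (∀ x ∈ Set.Ioo (Real.log ζl) (Real.log (K1 ^ 2 / ζl ^ 2)),
        deriv (deriv Φ) x = 0 ↔ x = Real.log ζc) := by
  have hsq : 0 < Real.sqrt ζl := Real.sqrt_pos.mpr hζl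
  have hsq2 : Real.sqrt ζl ^ 2 = ζl := Real.sq_sqrt hζl.le
  set K : ℝ := K1 ^ 2 with hKdef
  obtain ⟨v, hv⟩ : ∃ v, v = s - wl / ζl := ⟨_, rfl⟩
  have hvs : Real.sqrt ζl < v := by linarith
  have hv2 : ζl < v ^ 2 := by nlinarith
  have hKv : K = ζl ^ 2 * v ^ 2 := by
    rw [hKdef, hK1, hv]; field_simp; ring
  have hKl : ζl ^ 3 < K := by
    rw [hKv]
    have : 0 < ζl ^ 2 := by positivity
    nlinarith
  have hKpos : 0 < K := lt_trans (by positivity) hKl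
  obtain ⟨C, hC⟩ : ∃ C, C = K2 - s * K1 := ⟨_, rfl⟩
  have hC2 : C = ζl ^ 2 / 2 + K / ζl := by
    rw [hC, hKdef, hK2, hK1]; field_simp; ring
  have hCl : C * ζl = ζl ^ 3 / 2 + K := by
    rw [hC2]; field_simp
  have hCpos : 0 < C := by rw [hC2]; positivity
  rw [← hC] at hF
  obtain ⟨R, hR⟩ : ∃ R, R = Real.sqrt ((8 * K + ζl ^ 3) / ζl) := ⟨_, rfl⟩
  rw [← hR] at hζr
  have hR0 : 0 ≤ R := hR ▸ Real.sqrt_nonneg _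
  have hR2 : R ^ 2 * ζl = 8 * K + ζl ^ 3 := by
    rw [hR, Real.sq_sqrt (by positivity)]; field_simp
  have hRl : 3 * ζl < R := by
    by_contra h
    push Not at h
    have h1 : R ^ 2 ≤ (3 * ζl) ^ 2 := pow_le_pow_left₀ hR0 h 2
    nlinarith [mul_le_mul_of_nonneg_right h1 hζl.le]
  have hrl : ζl < ζr := by linarith
  have hr0 : 0 < ζr := by linarith
  have hKr : 2 * K = ζl * ζr * (ζr + ζl) := by
    have : R = 2 * ζr + ζl := by linarith
    rw [this] at hR2
    linarith
  have hCr : C = (ζl ^ 2 + ζr * (ζr + ζl)) / 2 := by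
    have : C * ζl = (ζl ^ 2 + ζr * (ζr + ζl)) / 2 * ζl := by rw [hCl]; linarith
    exact mul_right_cancel₀ hζl.ne' this
  obtain ⟨p, hp⟩ : ∃ p : ℝ → ℝ, p = fun x => x ^ 3 / 2 + C * x - 2 * K := ⟨_, rfl⟩
  have hFd : ∀ x, 0 < x → HasDerivAt F (p x / x ^ 3) x := by
    intro x hx
    have hFe : F = fun ζ => ζ / 2 + K / ζ ^ 2 - C / ζ := funext hF
    rw [hFe]
    have h1 := (hasDerivAt_id x).div_const 2
    have h2 := (hasDerivAt_const x K).div (hasDerivAt_pow 2 x) (by positivity)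
    have h3 := (hasDerivAt_const x C).div (hasDerivAt_id x) hx.ne'
    refine ((h1.add h2).sub h3).congr_deriv ?_
    rw [hp]
    simp only [id]
    field_simp
    push_cast
    ring
  have hmono : ∀ x y, 0 < x → x < y → p x < p y := by
    intro x y hx hxy
    rw [hp]
    have h1 : x ^ 3 < y ^ 3 := pow_lt_pow_left₀ hxy hx.le (by norm_num)
    have h2 : C * x < C * y := mul_lt_mul_of_pos_left hxy hCpos
    simp only
    linarith
  have hpl : p ζl < 0 := by rw [hp]; simp only; linarith
  have hpr : 0 < p ζr := by
    have h1 : p ζr = ζr * (ζr - ζl) * (ζr + ζl / 2) := by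
      rw [hp]; simp only; rw [hKr, hCr]; ring
    rw [h1]
    have : 0 < ζr - ζl := by linarith
    positivity
  have hpc : Continuous p := by rw [hp]; fun_prop
  obtain ⟨c, ⟨hlc, hcr⟩, hc0⟩ : (0 : ℝ) ∈ p '' Set.Ioo ζl ζr :=
    intermediate_value_Ioo hrl.le hpc.continuousOn ⟨hpl, hpr⟩
  have hcpos : 0 < c := hζl.trans hlc
  have hneg : ∀ x, 0 < x → x < c → deriv F x < 0 := by
    intro x hx hxc
    rw [(hFd x hx).deriv]
    exact div_neg_of_neg_of_pos (hc0 ▸ hmono x c hx hxc) (by positivity)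
  have hpos : ∀ x, c < x → 0 < deriv F x := by
    intro x hxc
    have hx := hcpos.trans hxc
    rw [(hFd x hx).deriv]
    exact div_pos (hc0 ▸ hmono c x hcpos hxc) (by positivity)
  have hzero : deriv F c = 0 := by rw [(hFd c hcpos).deriv, hc0, zero_div]
  have huniq : ∀ x, 0 < x → deriv F x = 0 → x = c := by
    intro x hx h
    rcases lt_trichotomy x c with h1 | h1 | h1
    · exact absurd h (hneg x hx h1).ne
    · exact h1
    · exact absurd h (hpos x h1).ne'
  have hcK : c < K / ζl ^ 2 := by
    refine hcr.trans ?_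
    rw [lt_div_iff₀ (by positivity)]
    have : 0 < ζl * ζr * (ζr - ζl) := by
      have : 0 < ζr - ζl := by linarith
      positivity
    nlinarith
  have hcomp : ∀ x, HasDerivAt (fun t => F (Real.exp t))
      (deriv F (Real.exp x) * Real.exp x) x := by
    intro x
    have h := hFd (Real.exp x) (Real.exp_pos x)
    rw [h.deriv]
    exact h.comp x (Real.hasDerivAt_exp x)
  have hcont : Continuous (fun t => F (Real.exp t)) :=
    continuous_iff_continuousAt.mpr fun x => (hcomp x).continuousAt
  have hΦ1 : deriv Φ = fun x => (3 / K) * F (Real.exp x) := by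
    funext x
    rw [show Φ = _ from funext hΦ]
    exact ((hcont.integral_hasStrictDerivAt (Real.log ζl) x).hasDerivAt.const_mul (3 / K)).deriv
  have hΦ2 : ∀ x, deriv (deriv Φ) x = (3 / K) * (deriv F (Real.exp x) * Real.exp x) := by
    intro x
    rw [hΦ1]
    exact ((hcomp x).const_mul (3 / K)).deriv
  refine ⟨c, hcpos, hzero, huniq, hlc, hcr, hneg, hpos,
    ⟨Real.log_lt_log hζl hlc, Real.log_lt_log hcpos hcK⟩, ?_⟩
  intro x _
  rw [hΦ2]
  constructor
  · intro h
    have h3 : (3 / K) ≠ 0 := by positivity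
    have h4 := (mul_eq_zero.mp h).resolve_left h3
    have h5 := (mul_eq_zero.mp h4).resolve_right (Real.exp_pos x).ne'
    rw [← huniq _ (Real.exp_pos x) h5, Real.log_exp]
  · rintro rfl
    rw [Real.exp_log hcpos, hzero]
    simp
end

section
/- Under the Lax condition one has ζ_l < ζ_r < ζ̄, where ζ̄ = K₁²/ζ_l². Moreover, letting ζ_c denote the unique positive zero of F' (which lies in (ζ_l, ζ_r)): F(ζ) < 0 for all ζ_l < ζ < ζ_r; F(ζ) > 0 for all ζ_r < ζ ≤ ζ̄; and F(ζ_c) ≤ F(ζ) ≤ F(ζ̄) for all ζ ∈ [ζ_l, ζ̄]; in particular F(ζ_c) < 0 < F(ζ̄). -/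
/-- Under the Lax condition, `ζ_l < ζ_r < ζ̄ = K₁²/ζ_l²`; the unique positive zero
`ζ_c` of `F'` lies in `(ζ_l, ζ_r)`; `F < 0` on `(ζ_l, ζ_r)`, `F > 0` on `(ζ_r, ζ̄]`,
and `F(ζ_c) ≤ F(ζ) ≤ F(ζ̄)` on `[ζ_l, ζ̄]`; in particular `F(ζ_c) < 0 < F(ζ̄)`. -/
theorem stmt_9 (ζl wl s : ℝ) (hζl : 0 < ζl)
    (hlax : s > wl / ζl + Real.sqrt ζl)
    (K1 K2 : ℝ) (hK1 : K1 = wl - s * ζl)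
    (hK2 : K2 = -s * wl + ζl ^ 2 / 2 + wl ^ 2 / ζl)
    (F : ℝ → ℝ) (hF : ∀ ζ, F ζ = ζ / 2 + K1 ^ 2 / ζ ^ 2 - (K2 - s * K1) / ζ)
    (ζr : ℝ) (hζr : ζr = -ζl / 2 + (1 / 2) * Real.sqrt ((8 * K1 ^ 2 + ζl ^ 3) / ζl))
    (ζb : ℝ) (hζb : ζb = K1 ^ 2 / ζl ^ 2)
    (ζc : ℝ) (hζc : 0 < ζc ∧ deriv F ζc = 0 ∧
      ∀ ζ', 0 < ζ' → deriv F ζ' = 0 → ζ' = ζc) :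
    ζl < ζr ∧ ζr < ζb ∧ ζl < ζc ∧ ζc < ζr ∧
    (∀ ζ, ζl < ζ → ζ < ζr → F ζ < 0) ∧
    (∀ ζ, ζr < ζ → ζ ≤ ζb → 0 < F ζ) ∧
    (∀ ζ ∈ Set.Icc ζl ζb, F ζc ≤ F ζ ∧ F ζ ≤ F ζb) ∧
    F ζc < 0 ∧ 0 < F ζb := by
  obtain ⟨hc0, hc1, -⟩ := hζc
  have hsq := Real.sq_sqrt hζl.le
  have hsp := Real.sqrt_pos.2 hζl
  have hb : ζl < ζb := by
    have h1 : wl + Real.sqrt ζl * ζl < s * ζl := by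
      have h := mul_lt_mul_of_pos_right hlax hζl
      have e : (wl / ζl + Real.sqrt ζl) * ζl = wl + Real.sqrt ζl * ζl := by field_simp
      rwa [e] at h
    have h2 : (Real.sqrt ζl * ζl) ^ 2 < K1 ^ 2 := by
      have h3 : 0 < Real.sqrt ζl * ζl := by positivity
      rw [hK1]; nlinarith
    rw [hζb, lt_div_iff₀ (by positivity)]
    rw [mul_pow, hsq] at h2
    exact h2
  have hk : K1 ^ 2 = ζl ^ 2 * ζb := by rw [hζb]; field_simp
  have hA : K2 - s * K1 = ζl ^ 2 / 2 + ζl * ζb := by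
    rw [hK2, hζb, hK1]; field_simp; ring
  have hb0 : 0 < ζb := hζl.trans hb
  have hrr : ζr ^ 2 + ζl * ζr = 2 * ζl * ζb := by
    have e : (8 * K1 ^ 2 + ζl ^ 3) / ζl = 8 * ζl * ζb + ζl ^ 2 := by
      rw [hk]; field_simp
    rw [e] at hζr
    have h := Real.sq_sqrt (show 0 ≤ 8 * ζl * ζb + ζl ^ 2 by positivity)
    rw [hζr]; nlinarith
  have hr0 : -ζl / 2 ≤ ζr := by
    rw [hζr]; have := Real.sqrt_nonneg ((8 * K1 ^ 2 + ζl ^ 3) / ζl); linarith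
  rw [hk, hA] at hF
  clear hK1 hK2 hA hk hlax hζb hζr hsq hsp
  have hlr : ζl < ζr := by
    by_contra h
    push Not at h
    nlinarith [mul_pos hζl (sub_pos.2 hb), mul_nonneg (sub_nonneg.2 h) (show 0 ≤ ζr + ζl + ζl by linarith)]
  have hrp : 0 < ζr := hζl.trans hlr
  have hrb : ζr < ζb := by
    by_contra h
    push Not at h
    nlinarith [mul_pos hb0 (sub_pos.2 hb), mul_nonneg (sub_nonneg.2 h) (show 0 ≤ ζr + ζb + ζl by linarith)]
  have hfac : ∀ z, 0 < z → F z = (z - ζl) * (z - ζr) * (z + ζr + ζl) / (2 * z ^ 2) := by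
    intro z hz
    have e : (z - ζl) * (z - ζr) * (z + ζr + ζl) = (z - ζl) * (z ^ 2 + ζl * z - 2 * ζl * ζb) := by
      rw [← hrr]; ring
    rw [hF, e]; field_simp; ring
  have hcc : ζc ^ 3 + (ζl ^ 2 + 2 * ζl * ζb) * ζc = 4 * ζl ^ 2 * ζb := by
    have hd : HasDerivAt F (1 / 2 + (0 * ζc ^ 2 - ζl ^ 2 * ζb * (2 * ζc)) / (ζc ^ 2) ^ 2
        - (0 * ζc - (ζl ^ 2 / 2 + ζl * ζb) * 1) / ζc ^ 2) ζc := by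
      have hx := hasDerivAt_id' ζc
      have h2 : HasDerivAt (fun x : ℝ => x ^ 2) (2 * ζc) ζc := by
        simpa using hasDerivAt_pow 2 ζc
      have h := ((hx.div_const 2).add ((hasDerivAt_const ζc (ζl ^ 2 * ζb)).div h2
        (by positivity))).sub ((hasDerivAt_const ζc (ζl ^ 2 / 2 + ζl * ζb)).div hx hc0.ne')
      have e : F = _ := funext hF
      rw [e]; exact h
    rw [hd.deriv] at hc1
    field_simp at hc1
    nlinarith
  have hlc : ζl < ζc := by
    by_contra h
    push Not at h
    have h3 : ζc ^ 3 ≤ ζl ^ 3 := by gcongr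
    have h4 : (ζl ^ 2 + 2 * ζl * ζb) * ζc ≤ (ζl ^ 2 + 2 * ζl * ζb) * ζl := by gcongr
    nlinarith [mul_pos (pow_pos hζl 2) (sub_pos.2 hb)]
  have hcr : ζc < ζr := by
    by_contra h
    push Not at h
    have h3 : ζr ^ 3 ≤ ζc ^ 3 := by gcongr
    have h4 : (ζl ^ 2 + 2 * ζl * ζb) * ζr ≤ (ζl ^ 2 + 2 * ζl * ζb) * ζc := by gcongr
    have h5 : 0 < ζr * (2 * ζr + ζl) * (ζr - ζl) :=
      mul_pos (by positivity) (sub_pos.2 hlr)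
    have h6 : ζr ^ 3 + (ζl ^ 2 + 2 * ζl * ζb) * ζr - 4 * ζl ^ 2 * ζb
        = ζr * (2 * ζr + ζl) * (ζr - ζl) := by
      linear_combination (2 * ζl - ζr) * hrr
    linarith
  have hneg : ∀ ζ, ζl < ζ → ζ < ζr → F ζ < 0 := by
    intro z h1 h2
    have hz := hζl.trans h1
    rw [hfac z hz]
    apply div_neg_of_neg_of_pos _ (by positivity)
    exact mul_neg_of_neg_of_pos (mul_neg_of_pos_of_neg (by linarith) (by linarith)) (by linarith)
  have hpos : ∀ ζ, ζr < ζ → ζ ≤ ζb → 0 < F ζ := by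
    intro z h1 _
    have hz := hrp.trans h1
    rw [hfac z hz]
    apply div_pos _ (by positivity)
    exact mul_pos (mul_pos (by linarith) (by linarith)) (by linarith)
  refine ⟨hlr, hrb, hlc, hcr, hneg, hpos, ?_, hneg _ hlc hcr, hpos _ hrb le_rfl⟩
  rintro z ⟨h1, h2⟩
  have hz : 0 < z := hζl.trans_le h1
  constructor
  · have e : F z - F ζc = (z - ζc) ^ 2 * (ζc * (2 * z + ζc) + (ζl ^ 2 + 2 * ζl * ζb))
        / (4 * ζc * z ^ 2) := by
      rw [hF, hF]; field_simp
      linear_combination (2 * (z ^ 2 - ζc ^ 2)) * hcc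
    have : 0 ≤ F z - F ζc := by rw [e]; positivity
    linarith
  · have e : F ζb - F z = (ζb - z) * (ζb * z ^ 2 + (2 * ζl * ζb - ζl ^ 2) * z - 2 * ζl ^ 2 * ζb)
        / (2 * ζb * z ^ 2) := by
      rw [hF, hF]; field_simp; ring
    have h3 : 0 ≤ ζb * z ^ 2 + (2 * ζl * ζb - ζl ^ 2) * z - 2 * ζl ^ 2 * ζb := by
      have h4 : ζb * ζl ^ 2 ≤ ζb * z ^ 2 := by gcongr
      have h5 : 0 ≤ 2 * ζl * ζb - ζl ^ 2 := by nlinarith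
      have h6 := mul_le_mul_of_nonneg_left h1 h5
      nlinarith [mul_pos (pow_pos hζl 2) (sub_pos.2 hb)]
    have : 0 ≤ F ζb - F z := by
      rw [e]; exact div_nonneg (mul_nonneg (by linarith) h3) (by positivity)
    linarith
end

section
/- The system z' = v, v' = −(3/K₁²)·F(e^z) − (3c/K₁²)·v with c > 0 has no nonconstant periodic solutions: if (z,v) : ℝ → ℝ² is a continuously differentiable solution and there exists P > 0 with z(ξ + P) = z(ξ) and v(ξ + P) = v(ξ) for all ξ ∈ ℝ, then z and v are constant functions. -/
/-- The system `z' = v`, `v' = −(3/K₁²)F(eᶻ) − (3c/K₁²)v` with `c > 0` has no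
nonconstant periodic solutions. -/
theorem stmt_10 (ζl wl s c : ℝ) (hζl : 0 < ζl) (hK1ne : wl - s * ζl ≠ 0) (hc : 0 < c)
    (K1 K2 : ℝ) (hK1 : K1 = wl - s * ζl)
    (hK2 : K2 = -s * wl + ζl ^ 2 / 2 + wl ^ 2 / ζl)
    (F : ℝ → ℝ) (hF : ∀ ζ, F ζ = ζ / 2 + K1 ^ 2 / ζ ^ 2 - (K2 - s * K1) / ζ)
    (z v : ℝ → ℝ) (hz : ContDiff ℝ 1 z) (hv : ContDiff ℝ 1 v)
    (hsys1 : ∀ ξ, deriv z ξ = v ξ)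
    (hsys2 : ∀ ξ, deriv v ξ = -(3 / K1 ^ 2) * F (Real.exp (z ξ))
      - (3 * c / K1 ^ 2) * v ξ)
    (P : ℝ) (hP : 0 < P)
    (hper : ∀ ξ, z (ξ + P) = z ξ ∧ v (ξ + P) = v ξ) :
    (∀ a b, z a = z b) ∧ (∀ a b, v a = v b) := by
  have hKne : K1 ≠ 0 := by rw [hK1]; exact hK1ne
  have hK : 0 < K1 ^ 2 := by positivity
  have hzd : ∀ ξ, HasDerivAt z (v ξ) ξ := fun ξ => by
    rw [← hsys1 ξ]
    exact ((hz.differentiable one_ne_zero) ξ).hasDerivAt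
  have hvd : ∀ ξ, HasDerivAt v (deriv v ξ) ξ := fun ξ =>
    ((hv.differentiable one_ne_zero) ξ).hasDerivAt
  -- the energy
  obtain ⟨E, hE⟩ : ∃ E : ℝ → ℝ, E = fun ξ => v ξ ^ 2 / 2 + (3 / K1 ^ 2) *
      (Real.exp (z ξ) / 2 - K1 ^ 2 / 2 * Real.exp (-2 * z ξ)
        + (K2 - s * K1) * Real.exp (-z ξ)) := ⟨_, rfl⟩
  have hEd : ∀ ξ, HasDerivAt E (-(3 * c / K1 ^ 2) * v ξ ^ 2) ξ := by
    intro ξ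
    have h1 := ((hvd ξ).pow 2).div_const 2
    have h2 := (hzd ξ).exp.div_const 2
    have h3 := (((hzd ξ).const_mul (-2)).exp).const_mul (K1 ^ 2 / 2)
    have h4 := ((hzd ξ).neg.exp).const_mul (K2 - s * K1)
    have h5 := h1.add (((h2.sub h3).add h4).const_mul (3 / K1 ^ 2))
    rw [hE]
    refine h5.congr_deriv ?_
    have e1 : Real.exp (-z ξ) = (Real.exp (z ξ))⁻¹ := Real.exp_neg _
    have e2 : Real.exp (-2 * z ξ) = (Real.exp (z ξ) ^ 2)⁻¹ := by
      rw [← Real.exp_nat_mul, ← Real.exp_neg]; congr 1; push_cast; ring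
    have e3 : Real.exp (z ξ) ≠ 0 := (Real.exp_pos _).ne'
    simp only [Pi.neg_apply]
    rw [hsys2, hF, e1, e2]
    field_simp
    ring
  have hanti : Antitone E := by
    apply antitone_of_deriv_nonpos (fun ξ => (hEd ξ).differentiableAt)
    intro ξ
    rw [(hEd ξ).deriv]
    have : 0 ≤ (3 * c / K1 ^ 2) * v ξ ^ 2 := by positivity
    linarith
  have hEper : Function.Periodic E P := by
    intro ξ
    simp only [hE, (hper ξ).1, (hper ξ).2]
  have hle : ∀ a b, E a ≤ E b := by
    intro a b
    obtain ⟨n, hn⟩ := exists_nat_ge ((b - a) / P)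
    have h1 : b ≤ a + n * P := by
      rw [div_le_iff₀ hP] at hn
      linarith
    have h2 := hanti h1
    rwa [hEper.nat_mul n a] at h2
  have hv0 : ∀ ξ, v ξ = 0 := by
    intro ξ
    have hc' : E = fun _ => E 0 := funext fun x => le_antisymm (hle _ _) (hle _ _)
    have h1 := hEd ξ
    rw [hc'] at h1
    have h2 := h1.unique (hasDerivAt_const ξ (E 0))
    have h3 : (3 * c / K1 ^ 2) ≠ 0 := by positivity
    have h4 : v ξ ^ 2 = 0 := (mul_eq_zero.mp h2).resolve_left (neg_ne_zero.mpr h3)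
    exact pow_eq_zero_iff (two_ne_zero) |>.mp h4
  refine ⟨fun a b => ?_, fun a b => by rw [hv0, hv0]⟩
  exact is_const_of_deriv_eq_zero (hz.differentiable one_ne_zero)
    (fun ξ => by rw [hsys1, hv0]) a b
end

section
/- For every c > 0 there exists a nonconstant, twice continuously differentiable function z : ℝ → ℝ solving (K₁²/3)·z''(ξ) + c·z'(ξ) + F(e^{z(ξ)}) = 0 for all ξ ∈ ℝ, such that z(ξ) → ln ζ_l as ξ → −∞, z(ξ) → ln ζ_r as ξ → +∞, z'(ξ) → 0 as ξ → ±∞, and ln ζ_l < z(ξ) < ln(K₁²/ζ_l²) for all ξ ∈ ℝ. -/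
section TW
open Set Filter Topology MeasureTheory

lemma tw_hasDerivAt_Iic (g : ℝ → ℝ) (hg : Continuous g) (hi : ∀ ξ, IntegrableOn g (Iic ξ)) (ξ : ℝ) :
    HasDerivAt (fun ξ => ∫ τ in Iic ξ, g τ) (g ξ) ξ := by
  have h : (fun ξ => ∫ τ in Iic ξ, g τ) = fun ξ => (∫ τ in Iic (0:ℝ), g τ) + ∫ τ in (0:ℝ)..ξ, g τ := by
    funext x
    rw [← intervalIntegral.integral_Iic_sub_Iic (hi 0) (hi x)]; ring
  rw [h]
  exact (intervalIntegral.integral_hasDerivAt_right (hg.intervalIntegrable _ _)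
    hg.stronglyMeasurable.stronglyMeasurableAtFilter hg.continuousAt).const_add _

lemma tw_int (g q : ℝ → ℝ) (hg : Continuous g) (hq : ∀ ξ, IntegrableOn q (Iic ξ))
    (hgq : ∀ τ, |g τ| ≤ q τ) (ξ : ℝ) : IntegrableOn g (Iic ξ) :=
  (hq ξ).mono' hg.aestronglyMeasurable (ae_of_all _ hgq)

lemma tw_int2 (nu : ℝ) (hnu : 0 < nu) (g q : ℝ → ℝ) (hg : Continuous g) (hq : ∀ ξ, IntegrableOn q (Iic ξ))
    (hgq : ∀ τ, |g τ| ≤ q τ) (ξ : ℝ) : IntegrableOn (fun τ => Real.exp (nu * τ) * g τ) (Iic ξ) := by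
  refine ((hq ξ).const_mul (Real.exp (nu * ξ))).mono' (by fun_prop) ?_
  refine (ae_restrict_iff' measurableSet_Iic).2 (ae_of_all _ fun τ hτ => ?_)
  rw [Real.norm_eq_abs, abs_mul, abs_of_pos (Real.exp_pos _)]
  have : Real.exp (nu * τ) ≤ Real.exp (nu * ξ) :=
    Real.exp_le_exp.2 (mul_le_mul_of_nonneg_left hτ hnu.le)
  exact mul_le_mul this (hgq τ) (abs_nonneg _) (Real.exp_pos _).le

lemma tw_b1 (g q : ℝ → ℝ) (hq : ∀ ξ, IntegrableOn q (Iic ξ))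
    (hgq : ∀ τ, |g τ| ≤ q τ) (ξ : ℝ) : |∫ τ in Iic ξ, g τ| ≤ ∫ τ in Iic ξ, q τ :=
  norm_integral_le_of_norm_le (f := g) (hq ξ) (ae_of_all _ hgq)

lemma tw_b2 (nu : ℝ) (hnu : 0 < nu) (g q : ℝ → ℝ) (hq : ∀ ξ, IntegrableOn q (Iic ξ))
    (hgq : ∀ τ, |g τ| ≤ q τ) (ξ : ℝ) :
    |Real.exp (-nu * ξ) * ∫ τ in Iic ξ, Real.exp (nu * τ) * g τ| ≤ ∫ τ in Iic ξ, q τ := by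
  rw [← integral_const_mul]
  refine norm_integral_le_of_norm_le
    (f := fun τ => Real.exp (-nu * ξ) * (Real.exp (nu * τ) * g τ)) (hq ξ) ?_
  refine (ae_restrict_iff' measurableSet_Iic).2 (ae_of_all _ fun τ hτ => ?_)
  rw [← mul_assoc, ← Real.exp_add, Real.norm_eq_abs, abs_mul, abs_of_pos (Real.exp_pos _)]
  have : Real.exp (-nu * ξ + nu * τ) ≤ 1 := by
    rw [Real.exp_le_one_iff]; nlinarith [mul_le_mul_of_nonneg_left (show τ ≤ ξ from hτ) hnu.le]
  calc _ ≤ 1 * |g τ| := mul_le_mul_of_nonneg_right this (abs_nonneg _)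
    _ ≤ _ := by rw [one_mul]; exact hgq τ

/-- the Volterra operator -/
noncomputable def twP (nu : ℝ) (g : ℝ → ℝ) (ξ : ℝ) : ℝ :=
  (∫ τ in Iic ξ, g τ) - Real.exp (-nu * ξ) * ∫ τ in Iic ξ, Real.exp (nu * τ) * g τ

lemma twP_deriv (nu : ℝ) (hnu : 0 < nu) (g q : ℝ → ℝ) (hg : Continuous g)
    (hq : ∀ ξ, IntegrableOn q (Iic ξ)) (hgq : ∀ τ, |g τ| ≤ q τ) (ξ : ℝ) :
    HasDerivAt (twP nu g)
      (nu * (Real.exp (-nu * ξ) * ∫ τ in Iic ξ, Real.exp (nu * τ) * g τ)) ξ ∧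
    HasDerivAt (fun ξ => nu * (Real.exp (-nu * ξ) * ∫ τ in Iic ξ, Real.exp (nu * τ) * g τ))
      (-nu * (nu * (Real.exp (-nu * ξ) * ∫ τ in Iic ξ, Real.exp (nu * τ) * g τ)) + nu * g ξ) ξ := by
  have h1 := tw_hasDerivAt_Iic g hg (tw_int g q hg hq hgq) ξ
  have h2 := tw_hasDerivAt_Iic (fun τ => Real.exp (nu * τ) * g τ) (by fun_prop)
    (tw_int2 nu hnu g q hg hq hgq) ξ
  have h3 : HasDerivAt (fun ξ => Real.exp (-nu * ξ)) (Real.exp (-nu * ξ) * (-nu)) ξ := by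
    simpa using ((hasDerivAt_id ξ).const_mul (-nu)).exp
  have h4 := h3.mul h2
  have e : Real.exp (-nu * ξ) * Real.exp (nu * ξ) = 1 := by
    rw [← Real.exp_add]; simp
  refine ⟨(h1.sub h4).congr_deriv ?_, (h4.const_mul nu).congr_deriv ?_⟩
  · linear_combination (- g ξ) * e
  · linear_combination (nu * g ξ) * e

lemma twP_sub (nu : ℝ) (hnu : 0 < nu) (g g' q q' : ℝ → ℝ) (hg : Continuous g) (hg' : Continuous g')
    (hq : ∀ ξ, IntegrableOn q (Iic ξ)) (hgq : ∀ τ, |g τ| ≤ q τ)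
    (hgq' : ∀ τ, |g' τ| ≤ q τ) (hq' : ∀ ξ, IntegrableOn q' (Iic ξ))
    (h : ∀ τ, |g τ - g' τ| ≤ q' τ) (ξ : ℝ) :
    |twP nu g ξ - twP nu g' ξ| ≤ 2 * ∫ τ in Iic ξ, q' τ := by
  have e : twP nu g ξ - twP nu g' ξ = (∫ τ in Iic ξ, (g τ - g' τ)) -
      Real.exp (-nu * ξ) * ∫ τ in Iic ξ, Real.exp (nu * τ) * (g τ - g' τ) := by
    simp only [mul_sub]
    rw [integral_sub (tw_int g q hg hq hgq ξ) (tw_int g' q hg' hq hgq' ξ),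
      integral_sub (tw_int2 nu hnu g q hg hq hgq ξ) (tw_int2 nu hnu g' q hg' hq hgq' ξ)]
    unfold twP; ring
  rw [e]
  have a1 := tw_b1 _ q' hq' h ξ
  have a2 := tw_b2 nu hnu _ q' hq' h ξ
  refine (abs_sub _ _).trans ?_
  linarith

lemma twP_abs (nu : ℝ) (hnu : 0 < nu) (g q : ℝ → ℝ) 
    (hq : ∀ ξ, IntegrableOn q (Iic ξ)) (hgq : ∀ τ, |g τ| ≤ q τ) (ξ : ℝ) :
    |twP nu g ξ| ≤ 2 * ∫ τ in Iic ξ, q τ := by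
  have a1 := tw_b1 _ q hq hgq ξ
  have a2 := tw_b2 nu hnu _ q hq hgq ξ
  unfold twP
  refine (abs_sub _ _).trans ?_
  linarith

lemma tw_exists_v (lam nu m M L : ℝ) (hlam : 0 < lam) (hnu : 0 < nu) (hm : 0 < m) (hM : 0 < M)
    (hL : 0 < L) (N : ℝ → ℝ) (hN : Continuous N) (hN0 : N 0 = 0)
    (h1 : ∀ x y, |N x - N y| ≤ L * max |x| |y| * |x - y|)
    (h2 : ∀ x y, |N x - N y| ≤ M * |x - y|) :
    ∃ v v' : ℝ → ℝ, ∃ a C : ℝ, 0 < a ∧ (∀ ξ, HasDerivAt v (v' ξ) ξ) ∧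
      (∀ ξ, HasDerivAt v' (-nu * v' ξ + Real.exp (-lam * ξ) * N (Real.exp (lam * ξ) * v ξ) / m) ξ) ∧
      (∀ ξ ≤ 0, a / 2 ≤ v ξ ∧ v ξ ≤ 2 * a ∧ |v' ξ| ≤ C) := by
  set B : ℝ := lam + 16 * M / (m * nu) with hB
  have hBpos : 0 < B := by positivity
  set a : ℝ := lam * (m * nu) / (32 * L) with ha
  have hapos : 0 < a := by positivity
  set q : ℝ → ℝ := fun τ => 2 * a * L * Real.exp (lam * τ) + M * Real.exp (B * τ) with hqdef
  set e : ℝ → ℝ := fun τ => Real.exp (B * max τ 0) with hedef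
  have hepos : ∀ τ, 0 < e τ := fun τ => Real.exp_pos _
  have hecont : Continuous e := by fun_prop
  have hqint : ∀ ξ, IntegrableOn q (Iic ξ) := fun ξ =>
    ((integrableOn_exp_mul_Iic hlam ξ).const_mul _).add ((integrableOn_exp_mul_Iic hBpos ξ).const_mul _)
  have hqint2 : ∀ d ξ, IntegrableOn (fun τ => d * q τ) (Iic ξ) := fun d ξ => (hqint ξ).const_mul d
  have hqval : ∀ ξ, 1 / (m * nu) * (2 * ∫ τ in Iic ξ, q τ) ≤ 1 / 4 * e ξ := by
    intro ξ
    rw [hqdef, integral_add ((integrableOn_exp_mul_Iic hlam ξ).const_mul _)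
      ((integrableOn_exp_mul_Iic hBpos ξ).const_mul _), integral_const_mul, integral_const_mul,
      integral_exp_mul_Iic hlam, integral_exp_mul_Iic hBpos]
    have b1 : Real.exp (lam * ξ) ≤ e ξ := by
      apply Real.exp_le_exp.2
      have : lam ≤ B := by rw [hB]; have : 0 < 16 * M / (m * nu) := by positivity
                           linarith
      calc lam * ξ ≤ lam * max ξ 0 := mul_le_mul_of_nonneg_left (le_max_left _ _) hlam.le
        _ ≤ _ := mul_le_mul_of_nonneg_right this (le_max_right _ _)
    have b2 : Real.exp (B * ξ) ≤ e ξ := by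
      apply Real.exp_le_exp.2
      exact mul_le_mul_of_nonneg_left (le_max_left _ _) hBpos.le
    have c1 : 1 / (m * nu) * (2 * (2 * a * L * (1 / lam))) = 1 / 8 := by
      rw [ha]; field_simp; norm_num
    have c2 : 1 / (m * nu) * (2 * (M * (1 / B))) ≤ 1 / 8 := by
      rw [show 1 / (m * nu) * (2 * (M * (1 / B))) = (16 * M / (m * nu)) / (8 * B) by field_simp; norm_num]
      rw [div_le_div_iff₀ (by positivity) (by norm_num)]
      rw [hB]; linarith
    calc _ = 1 / (m * nu) * (2 * (2 * a * L * (1 / lam))) * Real.exp (lam * ξ)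
          + 1 / (m * nu) * (2 * (M * (1 / B))) * Real.exp (B * ξ) := by field_simp
      _ ≤ 1 / 8 * e ξ + 1 / 8 * e ξ := by
          rw [c1]
          exact add_le_add (mul_le_mul_of_nonneg_left b1 (by norm_num))
            (mul_le_mul c2 b2 (Real.exp_pos _).le (by norm_num))
      _ = _ := by ring
  let g : (ℝ → ℝ) → ℝ → ℝ := fun w τ => Real.exp (-lam * τ) * N (Real.exp (lam * τ) * (e τ * w τ))
  have hgcont : ∀ w, Continuous w → Continuous (g w) := by
    intro w hw
    have : Continuous fun τ => N (Real.exp (lam * τ) * (e τ * w τ)) := hN.comp (by fun_prop)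
    exact Continuous.mul (by fun_prop) this
  have hgdiff : ∀ (w w' : ℝ → ℝ) d, (∀ τ, |w τ| ≤ 2 * a) → (∀ τ, |w' τ| ≤ 2 * a) →
      (∀ τ, |w τ - w' τ| ≤ d) → ∀ τ, |g w τ - g w' τ| ≤ d * q τ := by
    intro w w' d hw hw' hd τ
    have hd0 : 0 ≤ d := (abs_nonneg _).trans (hd τ)
    have hE := Real.exp_pos (lam * τ)
    have ee : Real.exp (-lam * τ) * Real.exp (lam * τ) = 1 := by rw [← Real.exp_add]; simp
    have e0 : |g w τ - g w' τ| = Real.exp (-lam * τ) *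
        |N (Real.exp (lam * τ) * (e τ * w τ)) - N (Real.exp (lam * τ) * (e τ * w' τ))| := by
      simp only [g]; rw [← mul_sub, abs_mul, abs_of_pos (Real.exp_pos _)]
    have e1 : |Real.exp (lam * τ) * (e τ * w τ) - Real.exp (lam * τ) * (e τ * w' τ)|
        = Real.exp (lam * τ) * e τ * |w τ - w' τ| := by
      rw [← mul_sub, ← mul_sub, abs_mul, abs_mul, abs_of_pos hE, abs_of_pos (hepos τ)]; ring
    rw [e0]
    rcases le_total τ 0 with ht | ht
    · have he : e τ = 1 := by simp [hedef, max_eq_right ht]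
      have k := h1 (Real.exp (lam * τ) * (e τ * w τ)) (Real.exp (lam * τ) * (e τ * w' τ))
      rw [e1] at k
      rw [he] at k ⊢
      simp only [one_mul, mul_one] at k ⊢
      have hmx : max |Real.exp (lam * τ) * w τ| |Real.exp (lam * τ) * w' τ| ≤ Real.exp (lam * τ) * (2 * a) := by
        rw [abs_mul, abs_mul, abs_of_pos hE]
        exact max_le (mul_le_mul_of_nonneg_left (hw τ) hE.le) (mul_le_mul_of_nonneg_left (hw' τ) hE.le)
      calc _ ≤ Real.exp (-lam * τ) * (L * (Real.exp (lam * τ) * (2 * a)) * (Real.exp (lam * τ) * d)) := by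
            refine mul_le_mul_of_nonneg_left (k.trans ?_) (Real.exp_pos _).le
            have := hd τ
            gcongr
        _ = d * (2 * a * L * Real.exp (lam * τ)) := by
            linear_combination (L * (2 * a) * (Real.exp (lam * τ) * d)) * ee
        _ ≤ d * q τ := by
            refine mul_le_mul_of_nonneg_left ?_ hd0
            have : 0 < M * Real.exp (B * τ) := by positivity
            simp only [hqdef]; linarith
    · have he : e τ = Real.exp (B * τ) := by simp [hedef, max_eq_left ht]
      have k := h2 (Real.exp (lam * τ) * (e τ * w τ)) (Real.exp (lam * τ) * (e τ * w' τ))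
      rw [e1] at k
      calc _ ≤ Real.exp (-lam * τ) * (M * (Real.exp (lam * τ) * e τ * d)) := by
            refine mul_le_mul_of_nonneg_left (k.trans ?_) (Real.exp_pos _).le
            have := hd τ
            have := (hepos τ).le
            gcongr
        _ = d * (M * Real.exp (B * τ)) := by
            rw [← he]
            linear_combination (M * e τ * d) * ee
        _ ≤ d * q τ := by
            refine mul_le_mul_of_nonneg_left ?_ hd0
            have : 0 < 2 * a * L * Real.exp (lam * τ) := by positivity
            simp only [hqdef]; linarith
  have hgabs : ∀ (w : ℝ → ℝ), (∀ τ, |w τ| ≤ 2 * a) → ∀ τ, |g w τ| ≤ 2 * a * q τ := by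
    intro w hw τ
    have := hgdiff w (fun _ => 0) (2 * a) hw (by intro; simp; positivity) (by simpa using hw) τ
    simpa [g, hN0] using this
  have hPabs : ∀ (w : ℝ → ℝ), (∀ τ, |w τ| ≤ 2 * a) → ∀ ξ,
      |1 / (m * nu) * twP nu (g w) ξ| ≤ a / 2 * e ξ := by
    intro w hw ξ
    have k := twP_abs nu hnu (g w) _ (hqint2 (2 * a)) (hgabs w hw) ξ
    rw [integral_const_mul] at k
    rw [abs_mul, abs_of_pos (by positivity)]
    have h3 := hqval ξ
    calc _ ≤ 1 / (m * nu) * (2 * (2 * a * ∫ τ in Iic ξ, q τ)) :=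
          mul_le_mul_of_nonneg_left k (by positivity)
      _ = 2 * a * (1 / (m * nu) * (2 * ∫ τ in Iic ξ, q τ)) := by ring
      _ ≤ 2 * a * (1 / 4 * e ξ) := mul_le_mul_of_nonneg_left h3 (by positivity)
      _ = _ := by ring
  let S := Metric.closedBall (0 : BoundedContinuousFunction ℝ ℝ) (2 * a)
  have hS : ∀ w : S, ∀ τ, |(w : BoundedContinuousFunction ℝ ℝ) τ| ≤ 2 * a := by
    intro w τ
    have := w.2
    rw [mem_closedBall_zero_iff] at this
    exact ((w : BoundedContinuousFunction ℝ ℝ).norm_coe_le_norm τ).trans this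
  have he1 : ∀ ξ, 1 ≤ e ξ := fun ξ => Real.one_le_exp (mul_nonneg hBpos.le (le_max_right _ _))
  let Tf : (ℝ → ℝ) → ℝ → ℝ := fun w ξ => (e ξ)⁻¹ * (a + 1 / (m * nu) * twP nu (g w) ξ)
  have hTc : ∀ w : ℝ → ℝ, Continuous w → (∀ τ, |w τ| ≤ 2 * a) → Continuous (Tf w) := by
    intro w hw hb
    have : Continuous (twP nu (g w)) := continuous_iff_continuousAt.2 fun ξ =>
      (twP_deriv nu hnu (g w) _ (hgcont w hw) (hqint2 (2 * a)) (hgabs w hb) ξ).1.continuousAt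
    have h5 : Continuous fun ξ => (e ξ)⁻¹ := hecont.inv₀ fun ξ => (hepos ξ).ne'
    exact h5.mul (by fun_prop)
  have hTb : ∀ w : ℝ → ℝ, (∀ τ, |w τ| ≤ 2 * a) → ∀ ξ, ‖Tf w ξ‖ ≤ 2 * a := by
    intro w hb ξ
    simp only [Tf, Real.norm_eq_abs]
    rw [abs_mul, abs_inv, abs_of_pos (hepos ξ), inv_mul_le_iff₀ (hepos ξ)]
    refine (abs_add_le _ _).trans ?_
    rw [abs_of_pos hapos]
    have := hPabs w hb ξ
    nlinarith [he1 ξ]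
  let T : S → S := fun w => ⟨BoundedContinuousFunction.ofNormedAddCommGroup (Tf w)
      (hTc w (w : BoundedContinuousFunction ℝ ℝ).continuous (hS w)) (2 * a) (hTb w (hS w)), by
        rw [mem_closedBall_zero_iff]
        exact BoundedContinuousFunction.norm_ofNormedAddCommGroup_le _ (by positivity) _⟩
  have hTcontr : ContractingWith (1/2) T := by
    refine ⟨by rw [← NNReal.coe_lt_coe]; norm_num, LipschitzWith.of_dist_le_mul fun w w' => ?_⟩
    rw [Subtype.dist_eq, Subtype.dist_eq, BoundedContinuousFunction.dist_le (by positivity)]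
    intro ξ
    have hd : ∀ τ, |(w : BoundedContinuousFunction ℝ ℝ) τ - (w' : BoundedContinuousFunction ℝ ℝ) τ|
        ≤ dist (w : BoundedContinuousFunction ℝ ℝ) w' := fun τ =>
      BoundedContinuousFunction.dist_coe_le_dist (f := (w : BoundedContinuousFunction ℝ ℝ))
        (g := (w' : BoundedContinuousFunction ℝ ℝ)) τ
    have k := twP_sub nu hnu _ _ _ _ (hgcont w (w : BoundedContinuousFunction ℝ ℝ).continuous)
      (hgcont w' (w' : BoundedContinuousFunction ℝ ℝ).continuous)
      (hqint2 (2 * a)) (hgabs w (hS w)) (hgabs w' (hS w')) (hqint2 _)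
      (hgdiff w w' _ (hS w) (hS w') hd) ξ
    rw [integral_const_mul] at k
    have h3 := hqval ξ
    change |Tf w ξ - Tf w' ξ| ≤ _
    have : Tf w ξ - Tf w' ξ = (e ξ)⁻¹ * (1 / (m * nu) * (twP nu (g w) ξ - twP nu (g w') ξ)) := by
      simp only [Tf]; ring
    rw [this, abs_mul, abs_inv, abs_of_pos (hepos ξ), inv_mul_le_iff₀ (hepos ξ), abs_mul,
      abs_of_pos (by positivity)]
    set δ := dist (w : BoundedContinuousFunction ℝ ℝ) w'
    have hδ : 0 ≤ δ := dist_nonneg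
    calc _ ≤ 1 / (m * nu) * (2 * (δ * ∫ τ in Iic ξ, q τ)) :=
          mul_le_mul_of_nonneg_left k (by positivity)
      _ = δ * (1 / (m * nu) * (2 * ∫ τ in Iic ξ, q τ)) := by ring
      _ ≤ δ * (1 / 4 * e ξ) := mul_le_mul_of_nonneg_left h3 hδ
      _ ≤ _ := by
          have : 0 ≤ δ * e ξ := mul_nonneg hδ (hepos ξ).le
          push_cast
          linarith
  have : CompleteSpace S := Metric.isClosed_closedBall.completeSpace_coe
  have : Nonempty S := ⟨⟨0, by simp [S]; positivity⟩⟩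
  obtain ⟨w, hw⟩ : ∃ w : S, T w = w := ⟨_, hTcontr.fixedPoint_isFixedPt⟩
  have hwb := hS w
  have hwc := (w : BoundedContinuousFunction ℝ ℝ).continuous
  have hw2 : ∀ ξ, e ξ * (w : BoundedContinuousFunction ℝ ℝ) ξ = a + 1 / (m * nu) * twP nu (g w) ξ := by
    intro ξ
    have : (w : BoundedContinuousFunction ℝ ℝ) ξ = Tf w ξ := by
      conv_lhs => rw [← hw]
      rfl
    rw [this]; simp only [Tf]
    rw [mul_inv_cancel_left₀ (hepos ξ).ne']
  have hd := twP_deriv nu hnu (g w) _ (hgcont w hwc) (hqint2 (2 * a)) (hgabs w hwb)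
  refine ⟨fun ξ => a + 1 / (m * nu) * twP nu (g w) ξ, fun ξ => 1 / (m * nu) *
    (nu * (Real.exp (-nu * ξ) * ∫ τ in Iic ξ, Real.exp (nu * τ) * g w τ)), a, nu * a, hapos,
    fun ξ => ((hd ξ).1.const_mul _).const_add _, fun ξ => ?_, fun ξ hξ => ?_⟩
  · refine ((hd ξ).2.const_mul (1 / (m * nu))).congr_deriv ?_
    simp only []
    rw [← hw2]
    change _ = _ + g w ξ / m
    field_simp
  · have he : e ξ = 1 := by simp [hedef, max_eq_right hξ]
    have k := hPabs w hwb ξ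
    rw [he] at k
    have k' := abs_le.1 k
    refine ⟨by simp only []; linarith [k'.1], by simp only []; linarith [k'.2], ?_⟩
    have k2 := tw_b2 nu hnu (g w) _ (hqint2 (2 * a)) (hgabs w hwb) ξ
    rw [integral_const_mul] at k2
    have h3 := hqval ξ
    rw [he] at h3
    simp only []
    rw [abs_mul, abs_mul, abs_of_pos (by positivity : 0 < 1 / (m * nu)), abs_of_pos hnu]
    calc _ ≤ 1 / (m * nu) * (nu * (2 * a * ∫ τ in Iic ξ, q τ)) := by gcongr
      _ = nu * a * (1 / (m * nu) * (2 * ∫ τ in Iic ξ, q τ)) := by ring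
      _ ≤ nu * a * (1 / 4 * 1) := by gcongr
      _ ≤ _ := by nlinarith [mul_pos hnu hapos]

lemma tw_lip (f f' : ℝ → ℝ) (C : ℝ) (hf : ∀ x, HasDerivAt f (f' x) x) (hb : ∀ x, |f' x| ≤ C) (x y : ℝ) :
    |f x - f y| ≤ C * |x - y| :=
  Convex.norm_image_sub_le_of_norm_hasDerivWithin_le (s := univ) (f := f) (f' := f')
    (fun x _ => (hf x).hasDerivWithinAt) (fun x _ => hb x) convex_univ (mem_univ _) (mem_univ _)

lemma tw_barbalat (f f' : ℝ → ℝ) (C l : ℝ) (hC : 0 ≤ C) (hf : ∀ x, HasDerivAt f (f' x) x)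
    (hL : ∀ x y, |f' x - f' y| ≤ C * |x - y|) (hl : Tendsto f atTop (𝓝 l)) :
    Tendsto f' atTop (𝓝 0) := by
  rw [Metric.tendsto_atTop]
  intro ε hε
  set h : ℝ := ε / (2 * (C + 1)) with hh
  have hpos : 0 < h := by positivity
  have ht : Tendsto (fun x => (f (x + h) - f x) / h) atTop (𝓝 0) := by
    have h1 : Tendsto (fun x => f (x + h)) atTop (𝓝 l) :=
      hl.comp (tendsto_atTop_add_const_right _ h tendsto_id)
    simpa using (h1.sub hl).div_const h
  obtain ⟨X, hX⟩ := Metric.tendsto_atTop.1 ht (ε / 2) (by positivity)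
  refine ⟨X, fun x hx => ?_⟩
  obtain ⟨y, hy, hy2⟩ := exists_hasDerivAt_eq_slope f f' (show x < x + h by linarith)
    (fun z _ => (hf z).continuousAt.continuousWithinAt) (fun z _ => hf z)
  have a1 := hX x hx
  rw [add_sub_cancel_left] at hy2
  rw [← hy2] at a1
  simp only [Real.dist_eq, sub_zero] at a1 ⊢
  have a2 := hL x y
  have a3 : |x - y| ≤ h := by rw [abs_le]; constructor <;> linarith [hy.1, hy.2]
  have a4 : C * |x - y| ≤ C * h := mul_le_mul_of_nonneg_left a3 hC
  have a5 : C * h ≤ ε / 2 := by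
    have : (C + 1) * h = ε / 2 := by rw [hh]; field_simp
    nlinarith
  have : |f' x| ≤ |f' x - f' y| + |f' y| := by
    simpa using abs_add_le (f' x - f' y) (f' y)
  linarith

lemma tw_dyn (m c k M D r : ℝ) (hm : 0 < m) (hc : 0 < c) (hk : 0 < k) (hM : 0 < M) (hD : 0 < D)
    (N V u u' : ℝ → ℝ) (hN0 : N 0 = 0)
    (h2 : ∀ x y, |N x - N y| ≤ M * |x - y|)
    (hV : ∀ x, HasDerivAt V (-(k * x) - N x) x) (hV0 : V 0 = 0) (hVD : V D = 0)
    (hz : ∀ x, 0 < x → x ≤ D → k * x + N x = 0 → x = r)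
    (hu : ∀ ξ, HasDerivAt u (u' ξ) ξ)
    (hu' : ∀ ξ, HasDerivAt u' ((-c * u' ξ + k * u ξ + N (u ξ)) / m) ξ)
    (hb : Tendsto u atBot (𝓝 0)) (hb' : Tendsto u' atBot (𝓝 0)) (hpos : ∀ ξ ≤ 0, 0 < u ξ) :
    (∀ ξ, 0 < u ξ ∧ u ξ < D) ∧ Tendsto u atTop (𝓝 r) ∧ Tendsto u' atTop (𝓝 0) := by
  have hVc : Continuous V := continuous_iff_continuousAt.2 fun x => (hV x).continuousAt
  have huc : Continuous u := continuous_iff_continuousAt.2 fun x => (hu x).continuousAt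
  set E : ℝ → ℝ := fun ξ => m / 2 * u' ξ ^ 2 + V (u ξ) with hE
  have hEd : ∀ ξ, HasDerivAt E (-c * u' ξ ^ 2) ξ := by
    intro ξ
    have h := (((hu' ξ).pow 2).const_mul (m / 2)).add ((hV (u ξ)).comp ξ (hu ξ))
    refine h.congr_deriv ?_
    field_simp
    ring
  have hanti : Antitone E := antitone_of_hasDerivAt_nonpos hEd (fun x => by
    have := mul_nonneg hc.le (sq_nonneg (u' x)); simp only [Pi.zero_apply]; linarith)
  have hEb : Tendsto E atBot (𝓝 0) := by
    have h1 : Tendsto (fun ξ => V (u ξ)) atBot (𝓝 (V 0)) := (hVc.tendsto 0).comp hb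
    have := ((hb'.pow 2).const_mul (m / 2)).add h1
    simpa [hV0] using this
  have hE0 : ∀ ξ, E ξ ≤ 0 := fun ξ => ge_of_tendsto hEb
    ((eventually_le_atBot ξ).mono fun x hx => hanti hx)
  have hEneg : ∀ ξ, E ξ < 0 := by
    intro ξ
    refine lt_of_le_of_ne (hE0 ξ) fun h0 => ?_
    have hz : ∀ x ≤ ξ, E x = 0 := fun x hx => le_antisymm (hE0 x) (h0 ▸ hanti hx)
    have hd0 : ∀ x ∈ Iio ξ, u' x = 0 := by
      intro x hx
      have h1 : E =ᶠ[𝓝 x] fun _ => 0 := by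
        filter_upwards [Iio_mem_nhds hx] with y hy using hz y (le_of_lt hy)
      have h3 : -c * u' x ^ 2 = 0 :=
        (hEd x).unique ((hasDerivAt_const x (0:ℝ)).congr_of_eventuallyEq h1)
      have : u' x ^ 2 = 0 := by
        rcases mul_eq_zero.1 h3 with h | h
        · linarith
        · exact h
      simpa using this
    have hconst : ∀ x ∈ Iio ξ, ∀ y ∈ Iio ξ, u x = u y := by
      intro x hx y hy
      have := Convex.norm_image_sub_le_of_norm_hasDerivWithin_le (s := Iio ξ) (f := u) (f' := u') (C := 0)
        (fun x _ => (hu x).hasDerivWithinAt) (fun x hx => by simp [hd0 x hx]) (convex_Iio ξ) hy hx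
      rw [zero_mul, norm_le_zero_iff, sub_eq_zero] at this
      exact this
    have hx0 : min ξ 0 - 1 ∈ Iio ξ := by
      have := min_le_left ξ 0
      simp only [mem_Iio]; linarith
    have : Tendsto u atBot (𝓝 (u (min ξ 0 - 1))) := by
      refine tendsto_const_nhds.congr' ?_
      filter_upwards [eventually_lt_atBot ξ] with y hy using hconst _ hx0 _ hy
    have := tendsto_nhds_unique this hb
    have h5 := hpos (min ξ 0 - 1) (by have := min_le_right ξ 0; linarith)
    linarith
  have hVneg : ∀ ξ, V (u ξ) < 0 := by
    intro ξ
    have h1 := hEneg ξ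
    have h3 : 0 ≤ m / 2 * u' ξ ^ 2 := by positivity
    simp only [hE] at h1; linarith
  have hne0 : ∀ ξ, u ξ ≠ 0 := fun ξ h => by have := hVneg ξ; rw [h, hV0] at this; exact lt_irrefl _ this
  have hneD : ∀ ξ, u ξ ≠ D := fun ξ h => by have := hVneg ξ; rw [h, hVD] at this; exact lt_irrefl _ this
  obtain ⟨ξ0, hξ0, hξ0'⟩ : ∃ ξ0, ξ0 ≤ 0 ∧ u ξ0 < D :=
    ((eventually_le_atBot (0:ℝ)).and (hb.eventually_lt_const hD)).exists
  have hbd : ∀ ξ, 0 < u ξ ∧ u ξ < D := by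
    intro ξ
    constructor
    · by_contra h
      push Not at h
      obtain ⟨x, hx⟩ := mem_range_of_exists_le_of_exists_ge huc ⟨ξ, h⟩ ⟨ξ0, (hpos ξ0 hξ0).le⟩
      exact hne0 x hx
    · by_contra h
      push Not at h
      obtain ⟨x, hx⟩ := mem_range_of_exists_le_of_exists_ge huc ⟨ξ0, hξ0'.le⟩ ⟨ξ, h⟩
      exact hneD x hx
  obtain ⟨W, hW⟩ := isCompact_Icc.exists_bound_of_continuousOn (s := Icc 0 D) hVc.continuousOn
  have hW' : ∀ ξ, |V (u ξ)| ≤ W := fun ξ => hW _ ⟨(hbd ξ).1.le, (hbd ξ).2.le⟩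
  have hW0 : 0 ≤ W := (abs_nonneg _).trans (hW' 0)
  set P : ℝ := 2 * W / m + 1 with hP
  have hP0 : 0 < P := by positivity
  have hu'b : ∀ ξ, |u' ξ| ≤ P := by
    intro ξ
    have h1 := (hEneg ξ).le
    simp only [hE] at h1
    have h3 := (abs_le.1 (hW' ξ)).1
    have h4 : u' ξ ^ 2 ≤ 2 * W / m := by rw [le_div_iff₀ hm]; linarith
    rw [abs_le]; constructor <;> nlinarith
  have hNb : ∀ ξ, |N (u ξ)| ≤ M * D := by
    intro ξ
    have := h2 (u ξ) 0
    rw [hN0, sub_zero, sub_zero, abs_of_pos (hbd ξ).1] at this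
    exact this.trans (mul_le_mul_of_nonneg_left (hbd ξ).2.le hM.le)
  set Q : ℝ := (c * P + k * D + M * D) / m with hQ
  have hQ0 : 0 < Q := by positivity
  have hu''b : ∀ ξ, |(-c * u' ξ + k * u ξ + N (u ξ)) / m| ≤ Q := by
    intro ξ
    rw [abs_div, abs_of_pos hm]
    refine div_le_div_of_nonneg_right ?_ hm.le
    refine (abs_add_three _ _ _).trans ?_
    rw [abs_mul, abs_mul, abs_neg, abs_of_pos hc, abs_of_pos hk, abs_of_pos (hbd ξ).1]
    have := hu'b ξ
    have := (hbd ξ).2.le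
    have := hNb ξ
    gcongr
  have hLu := tw_lip u u' P hu hu'b
  have hLu' := tw_lip u' _ Q hu' hu''b
  have hEt : Tendsto E atTop (𝓝 (⨅ i, E i)) := by
    refine tendsto_atTop_ciInf hanti ⟨-W, ?_⟩
    rintro _ ⟨ξ, rfl⟩
    have h3 := (abs_le.1 (hW' ξ)).1
    have h4 : 0 ≤ m / 2 * u' ξ ^ 2 := by positivity
    simp only [hE]; linarith
  have hE't := tw_barbalat E (fun ξ => -c * u' ξ ^ 2) (c * (2 * P * Q)) _ (by positivity) hEd (by
    intro x y
    rw [show -c * u' x ^ 2 - -c * u' y ^ 2 = -c * ((u' x + u' y) * (u' x - u' y)) by ring, abs_mul, abs_mul,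
      abs_neg, abs_of_pos hc]
    have i1 : |u' x + u' y| ≤ 2 * P := (abs_add_le _ _).trans (by linarith [hu'b x, hu'b y])
    have i2 := hLu' x y
    calc _ ≤ c * ((2 * P) * (Q * |x - y|)) := by gcongr
      _ = _ := by ring) hEt
  have hu't : Tendsto u' atTop (𝓝 0) := by
    have h1 : Tendsto (fun ξ => u' ξ ^ 2) atTop (𝓝 0) := by
      have := hE't.const_mul (-1 / c)
      simp only [mul_zero] at this
      refine this.congr fun ξ => ?_
      field_simp
    have h3 := h1.sqrt
    simp only [Real.sqrt_sq_eq_abs, Real.sqrt_zero] at h3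
    exact (tendsto_zero_iff_abs_tendsto_zero _).2 h3
  have hu''t := tw_barbalat u' _ ((c * Q + k * P + M * P) / m) 0 (by positivity) hu' (by
    intro x y
    rw [← sub_div, abs_div, abs_of_pos hm, div_mul_eq_mul_div]
    refine div_le_div_of_nonneg_right ?_ hm.le
    rw [show -c * u' x + k * u x + N (u x) - (-c * u' y + k * u y + N (u y)) =
      -c * (u' x - u' y) + k * (u x - u y) + (N (u x) - N (u y)) by ring]
    refine (abs_add_three _ _ _).trans ?_
    rw [abs_mul, abs_mul, abs_neg, abs_of_pos hc, abs_of_pos hk]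
    have i1 := hLu' x y
    have i2 := hLu x y
    have i3 := (h2 (u x) (u y)).trans (mul_le_mul_of_nonneg_left i2 hM.le)
    calc _ ≤ c * (Q * |x - y|) + k * (P * |x - y|) + M * (P * |x - y|) := by gcongr
      _ = _ := by ring) hu't
  have hGt : Tendsto (fun ξ => k * u ξ + N (u ξ)) atTop (𝓝 0) := by
    have := (hu''t.const_mul m).add (hu't.const_mul c)
    simp only [mul_zero, add_zero] at this
    refine this.congr fun ξ => ?_
    field_simp
    ring
  have hNc : Continuous N := (LipschitzWith.of_dist_le_mul (K := ⟨M, hM.le⟩) h2).continuous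
  refine ⟨hbd, ?_, hu't⟩
  refine (isCompact_Icc (a := (0:ℝ)) (b := D)).tendsto_nhds_of_unique_mapClusterPt
    (Eventually.of_forall fun ξ => ⟨(hbd ξ).1.le, (hbd ξ).2.le⟩) fun x hx hcl => ?_
  have e1 : MapClusterPt (k * x + N x) atTop (fun ξ => k * u ξ + N (u ξ)) :=
    hcl.tendsto_comp (f := fun x => k * x + N x) ((by fun_prop : Continuous fun x => k * x + N x).tendsto x)
  have e2 : k * x + N x = 0 := by
    have : ClusterPt (k * x + N x) (𝓝 0) := e1.clusterPt.mono hGt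
    by_contra hne
    have hbot := (disjoint_nhds_nhds.2 hne).eq_bot
    exact this.ne hbot
  have e3 : V x ≤ E 0 := by
    have h4 : MapClusterPt (V x) atTop (fun ξ => V (u ξ)) :=
      hcl.tendsto_comp (f := V) (hVc.tendsto x)
    have h5 : ClusterPt (V x) (𝓟 (Iic (E 0))) := h4.clusterPt.mono (by
      rw [le_principal_iff, mem_map]
      filter_upwards [eventually_ge_atTop (0:ℝ)] with ξ hξ
      have h6 := hanti hξ
      have h7 : 0 ≤ m / 2 * u' ξ ^ 2 := by positivity
      have h8 : E ξ = m / 2 * u' ξ ^ 2 + V (u ξ) := rfl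
      change V (u ξ) ≤ E 0
      linarith)
    exact isClosed_iff_clusterPt.1 isClosed_Iic _ h5
  refine hz x (lt_of_le_of_ne hx.1 fun h => ?_) hx.2 e2
  rw [← h, hV0] at e3
  exact absurd (hEneg 0) (not_lt.2 e3)

/-- the nonlinearity in the shifted logarithmic variable -/
noncomputable def twG (α β x : ℝ) : ℝ :=
  α * Real.exp x + β * Real.exp (-2 * x) - (α + β) * Real.exp (-x)

lemma tw_N (α β D : ℝ) (hα : 0 < α) (hβ : 2 * α < β) (hD : 0 < D) :
    ∃ L > 0, ∀ x ∈ Icc 0 D, ∀ y ∈ Icc 0 D,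
      |(-(twG α β x + (β - 2 * α) * x)) - (-(twG α β y + (β - 2 * α) * y))| ≤ L * max x y * |x - y| := by
  have hβ0 : 0 < β := by linarith
  have he1 : ∀ a x : ℝ, HasDerivAt (fun x => Real.exp (a * x)) (a * Real.exp (a * x)) x := by
    intro a x
    have := ((hasDerivAt_id x).const_mul a).exp
    simpa [mul_comm] using this
  have d1 : ∀ x, HasDerivAt (fun x => -(twG α β x + (β - 2 * α) * x))
      (-(α * Real.exp x - 2 * β * Real.exp (-2 * x) + (α + β) * Real.exp (-x) + (β - 2 * α))) x := by
    intro x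
    have a1 := (Real.hasDerivAt_exp x).const_mul α
    have a2 := (he1 (-2) x).const_mul β
    have a3 := (he1 (-1) x).const_mul (α + β)
    have a4 := (hasDerivAt_id x).const_mul (β - 2 * α)
    have := (((a1.add a2).sub a3).add a4).neg
    simp only [neg_one_mul] at this
    refine this.congr_deriv ?_
    ring
  have d2 : ∀ x, HasDerivAt (fun x => -(α * Real.exp x - 2 * β * Real.exp (-2 * x) + (α + β) * Real.exp (-x) + (β - 2 * α)))
      (-(α * Real.exp x + 4 * β * Real.exp (-2 * x) - (α + β) * Real.exp (-x))) x := by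
    intro x
    have a1 := (Real.hasDerivAt_exp x).const_mul α
    have a2 := (he1 (-2) x).const_mul (2 * β)
    have a3 := (he1 (-1) x).const_mul (α + β)
    have := (((a1.sub a2).add a3).add_const (β - 2 * α)).neg
    simp only [neg_one_mul] at this
    refine this.congr_deriv ?_
    ring
  set L := α * Real.exp D + 4 * β + (α + β) with hL
  refine ⟨L, by positivity, ?_⟩
  have b2 : ∀ x ∈ Icc 0 D, |(-(α * Real.exp x + 4 * β * Real.exp (-2 * x) - (α + β) * Real.exp (-x)))| ≤ L := by
    intro x hx
    have i1 : Real.exp x ≤ Real.exp D := Real.exp_le_exp.2 hx.2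
    have i2 : Real.exp (-2 * x) ≤ 1 := Real.exp_le_one_iff.2 (by linarith [hx.1])
    have i3 : Real.exp (-x) ≤ 1 := Real.exp_le_one_iff.2 (by linarith [hx.1])
    have j1 := mul_le_mul_of_nonneg_left i1 hα.le
    have j2 := mul_le_mul_of_nonneg_left i2 (by positivity : 0 ≤ 4 * β)
    have j3 := mul_le_mul_of_nonneg_left i3 (by positivity : 0 ≤ α + β)
    have k1 : 0 < α * Real.exp x := by positivity
    have k2 : 0 < 4 * β * Real.exp (-2 * x) := by positivity
    have k3 : 0 < (α + β) * Real.exp (-x) := by positivity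
    have k4 : 0 < α * Real.exp D := by positivity
    rw [abs_le]; constructor <;> linarith
  have b1 : ∀ x ∈ Icc 0 D, |(-(α * Real.exp x - 2 * β * Real.exp (-2 * x) + (α + β) * Real.exp (-x) + (β - 2 * α)))| ≤ L * x := by
    intro x hx
    have := Convex.norm_image_sub_le_of_norm_hasDerivWithin_le (s := Icc 0 D)
      (fun x _ => (d2 x).hasDerivWithinAt) b2 (convex_Icc 0 D) ⟨le_refl 0, hD.le⟩ hx
    simp only [Real.norm_eq_abs, sub_zero, abs_of_nonneg hx.1] at this
    refine le_trans (le_of_eq ?_) this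
    congr 1
    simp
    ring
  intro x hx y hy
  have := Convex.norm_image_sub_le_of_norm_hasDerivWithin_le (s := Icc 0 (max x y)) (C := L * max x y)
      (fun x _ => (d1 x).hasDerivWithinAt) (fun z hz => (b1 z ⟨hz.1, hz.2.trans (max_le hx.2 hy.2)⟩).trans
        (mul_le_mul_of_nonneg_left hz.2 (by positivity))) (convex_Icc 0 _)
        ⟨hy.1, le_max_right _ _⟩ ⟨hx.1, le_max_left _ _⟩
  exact this

lemma tw_main (m c α β D r : ℝ) (hm : 0 < m) (hc : 0 < c) (hα : 0 < α) (hβ : 2 * α < β)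
    (hDe : Real.exp D = β / (2 * α))
    (hr : ∀ x, 0 < x → twG α β x = 0 → x = r) :
    ∃ u u' u'' : ℝ → ℝ, (∀ ξ, HasDerivAt u (u' ξ) ξ) ∧ (∀ ξ, HasDerivAt u' (u'' ξ) ξ) ∧
      (∀ ξ, m * u'' ξ + c * u' ξ + twG α β (u ξ) = 0) ∧ (∀ ξ, 0 < u ξ ∧ u ξ < D) ∧
      Tendsto u atBot (𝓝 0) ∧ Tendsto u' atBot (𝓝 0) ∧
      Tendsto u atTop (𝓝 r) ∧ Tendsto u' atTop (𝓝 0) := by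
  have hβ0 : 0 < β := by linarith
  have hD : 0 < D := by
    rw [← Real.exp_lt_exp, Real.exp_zero, hDe, lt_div_iff₀ (by positivity)]; linarith
  set k := β - 2 * α with hk
  have hk0 : 0 < k := by linarith
  obtain ⟨L, hL, hLip⟩ := tw_N α β D hα hβ hD
  set cl : ℝ → ℝ := fun x => max 0 (min x D) with hcl
  have clm : ∀ x, cl x ∈ Icc 0 D := fun x => ⟨le_max_left _ _, max_le hD.le (min_le_right _ _)⟩
  have clid : ∀ x ∈ Icc 0 D, cl x = x := fun x hx => by simp [hcl, hx.1, hx.2]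
  have cllip : ∀ x y, |cl x - cl y| ≤ |x - y| := by
    intro x y
    have h1 := abs_max_sub_max_le_abs (min x D) (min y D) 0
    have h2 := abs_min_sub_min_le_max x D y D
    simp only [hcl]
    rw [max_comm 0, max_comm 0]
    refine h1.trans (h2.trans ?_)
    simp
  have clabs : ∀ x, cl x ≤ |x| := fun x => max_le (abs_nonneg _) ((min_le_left _ _).trans (le_abs_self _))
  set N : ℝ → ℝ := fun x => -(twG α β (cl x) + k * cl x) with hN
  have N0 : N 0 = 0 := by
    have : cl 0 = 0 := clid 0 ⟨le_refl _, hD.le⟩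
    simp [hN, this, twG]
  have h1 : ∀ x y, |N x - N y| ≤ L * max |x| |y| * |x - y| := by
    intro x y
    refine (hLip _ (clm x) _ (clm y)).trans ?_
    have i1 : max (cl x) (cl y) ≤ max |x| |y| := max_le_max (clabs x) (clabs y)
    have i2 := cllip x y
    gcongr
  have h2 : ∀ x y, |N x - N y| ≤ (L * D) * |x - y| := by
    intro x y
    refine (hLip _ (clm x) _ (clm y)).trans ?_
    have i1 : max (cl x) (cl y) ≤ D := max_le (clm x).2 (clm y).2
    have i2 := cllip x y
    gcongr
  have hNc : Continuous N := (LipschitzWith.of_dist_le_mul (K := ⟨L * D, by positivity⟩) h2).continuous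
  have hNG : ∀ x ∈ Icc 0 D, k * x + N x = - twG α β x := by
    intro x hx
    simp only [hN, clid x hx]; ring
  obtain ⟨lam, hlam, hchar⟩ : ∃ lam : ℝ, 0 < lam ∧ m * lam ^ 2 + c * lam = k := by
    have hs : 0 ≤ c ^ 2 + 4 * m * k := by positivity
    have hs2 := Real.sq_sqrt hs
    have hs3 : c < Real.sqrt (c ^ 2 + 4 * m * k) := by
      apply Real.lt_sqrt_of_sq_lt
      have : 0 < 4 * m * k := by positivity
      linarith
    refine ⟨(-c + Real.sqrt (c ^ 2 + 4 * m * k)) / (2 * m), div_pos (by linarith) (by positivity), ?_⟩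
    set S := Real.sqrt (c ^ 2 + 4 * m * k)
    field_simp
    linear_combination hs2
  have hnu : 0 < 2 * lam + c / m := by positivity
  obtain ⟨v, v', a, C, ha, hv, hv', hvb⟩ := tw_exists_v lam (2 * lam + c / m) m (L * D) L hlam hnu hm
    (by positivity) hL N hNc N0 h1 h2
  have hexp : ∀ ξ, HasDerivAt (fun ξ => Real.exp (lam * ξ)) (lam * Real.exp (lam * ξ)) ξ := by
    intro x
    have := ((hasDerivAt_id x).const_mul lam).exp
    simpa [mul_comm] using this
  have hexpbot : Tendsto (fun ξ => Real.exp (lam * ξ)) atBot (𝓝 0) :=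
    Real.tendsto_exp_atBot.comp (tendsto_id.const_mul_atBot hlam)
  set u : ℝ → ℝ := fun ξ => Real.exp (lam * ξ) * v ξ with hudef
  set u' : ℝ → ℝ := fun ξ => Real.exp (lam * ξ) * (v' ξ + lam * v ξ) with hu'def
  have hu : ∀ ξ, HasDerivAt u (u' ξ) ξ := fun ξ =>
    ((hexp ξ).mul (hv ξ)).congr_deriv (by simp only [hu'def]; ring)
  have hu' : ∀ ξ, HasDerivAt u' ((-c * u' ξ + k * u ξ + N (u ξ)) / m) ξ := by
    intro ξ
    refine ((hexp ξ).mul ((hv' ξ).add ((hv ξ).const_mul lam))).congr_deriv ?_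
    have e : Real.exp (lam * ξ) * Real.exp (-lam * ξ) = 1 := by rw [← Real.exp_add]; simp
    change _ = (-c * (Real.exp (lam * ξ) * (v' ξ + lam * v ξ)) + k * (Real.exp (lam * ξ) * v ξ)
      + N (Real.exp (lam * ξ) * v ξ)) / m
    rw [← hchar]
    simp only [Pi.add_apply]
    generalize N (Real.exp (lam * ξ) * v ξ) = X
    generalize Real.exp (-lam * ξ) = Y at e ⊢
    field_simp
    linear_combination X * e
  have hb : Tendsto u atBot (𝓝 0) := by
    refine squeeze_zero_norm' ?_ (by simpa using hexpbot.mul_const (2 * a))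
    filter_upwards [eventually_le_atBot (0:ℝ)] with ξ hξ
    obtain ⟨i1, i2, i3⟩ := hvb ξ hξ
    rw [hudef, Real.norm_eq_abs, abs_mul, abs_of_pos (Real.exp_pos _), abs_of_pos (by linarith : 0 < v ξ)]
    gcongr
  have hb' : Tendsto u' atBot (𝓝 0) := by
    refine squeeze_zero_norm' ?_ (by simpa using hexpbot.mul_const (C + lam * (2 * a)))
    filter_upwards [eventually_le_atBot (0:ℝ)] with ξ hξ
    obtain ⟨i1, i2, i3⟩ := hvb ξ hξ
    rw [hu'def, Real.norm_eq_abs, abs_mul, abs_of_pos (Real.exp_pos _)]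
    have : |v' ξ + lam * v ξ| ≤ C + lam * (2 * a) := by
      refine (abs_add_le _ _).trans ?_
      rw [abs_mul, abs_of_pos hlam, abs_of_pos (by linarith : 0 < v ξ)]
      gcongr
    gcongr
  have hpos : ∀ ξ ≤ 0, 0 < u ξ := fun ξ hξ =>
    mul_pos (Real.exp_pos _) (by linarith [(hvb ξ hξ).1])
  have hfc : Continuous fun t => -(k * t) - N t := by fun_prop
  set V : ℝ → ℝ := fun x => ∫ t in (0:ℝ)..x, (-(k * t) - N t) with hVdef
  have hV : ∀ x, HasDerivAt V (-(k * x) - N x) x := fun x =>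
    intervalIntegral.integral_hasDerivAt_right (hfc.intervalIntegrable _ _)
      hfc.stronglyMeasurable.stronglyMeasurableAtFilter hfc.continuousAt
  have hVD : V D = 0 := by
    have he1 : ∀ a x : ℝ, HasDerivAt (fun x => Real.exp (a * x)) (a * Real.exp (a * x)) x := by
      intro a x
      have := ((hasDerivAt_id x).const_mul a).exp
      simpa [mul_comm] using this
    have hd : ∀ x ∈ uIcc 0 D, HasDerivAt (fun x => α * Real.exp x - β / 2 * Real.exp (-2 * x) + (α + β) * Real.exp (-1 * x))
        (-(k * x) - N x) x := by
      intro x hx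
      rw [uIcc_of_le hD.le] at hx
      have := hNG x hx
      rw [show -(k * x) - N x = twG α β x by linarith]
      have a1 := (Real.hasDerivAt_exp x).const_mul α
      have a2 := (he1 (-2) x).const_mul (β / 2)
      have a3 := (he1 (-1) x).const_mul (α + β)
      refine ((a1.sub a2).add a3).congr_deriv ?_
      simp only [twG, neg_one_mul]; ring
    have := intervalIntegral.integral_eq_sub_of_hasDerivAt hd (hfc.intervalIntegrable _ _)
    simp only [hVdef]
    rw [this]
    have x1 : Real.exp (-1 * D) = 2 * α / β := by
      rw [neg_one_mul, Real.exp_neg, hDe, inv_div]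
    have x2 : Real.exp (-2 * D) = (2 * α / β) ^ 2 := by
      rw [← x1, ← Real.exp_nat_mul]; congr 1; push_cast; ring
    rw [x1, x2, hDe]
    simp only [mul_zero, Real.exp_zero]
    field_simp
    ring
  obtain ⟨r1, r2, r3⟩ := tw_dyn m c k (L * D) D r hm hc hk0 (by positivity) hD N V u u' N0 h2 hV
    (by simp [hVdef]) hVD (fun x hx hxD hx0 => hr x hx (by
      have := hNG x ⟨hx.le, hxD⟩; linarith)) hu hu' hb hb' hpos
  refine ⟨u, u', _, hu, hu', fun ξ => ?_, r1, hb, hb', r2, r3⟩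
  have := hNG (u ξ) ⟨(r1 ξ).1.le, (r1 ξ).2.le⟩
  rw [mul_div_cancel₀ _ hm.ne']
  linarith

end TW

/-- Existence of traveling waves: for every `c > 0` there is a nonconstant `C²`
solution of `(K₁²/3)z'' + cz' + F(eᶻ) = 0` connecting `ln ζ_l` at `−∞` to
`ln ζ_r` at `+∞`, with `z' → 0` at `±∞` and `ln ζ_l < z < ln(K₁²/ζ_l²)`. -/
theorem stmt_11 (ζl wl s : ℝ) (hζl : 0 < ζl)
    (hlax : s > wl / ζl + Real.sqrt ζl)
    (K1 K2 : ℝ) (hK1 : K1 = wl - s * ζl)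
    (hK2 : K2 = -s * wl + ζl ^ 2 / 2 + wl ^ 2 / ζl)
    (F : ℝ → ℝ) (hF : ∀ ζ, F ζ = ζ / 2 + K1 ^ 2 / ζ ^ 2 - (K2 - s * K1) / ζ)
    (ζr : ℝ) (hζr : ζr = -ζl / 2 + (1 / 2) * Real.sqrt ((8 * K1 ^ 2 + ζl ^ 3) / ζl))
    (c : ℝ) (hc : 0 < c) :
    ∃ z : ℝ → ℝ, ContDiff ℝ 2 z ∧ (∃ a b, z a ≠ z b) ∧
      (∀ ξ, (K1 ^ 2 / 3) * deriv (deriv z) ξ + c * deriv z ξ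
        + F (Real.exp (z ξ)) = 0) ∧
      Filter.Tendsto z Filter.atBot (nhds (Real.log ζl)) ∧
      Filter.Tendsto z Filter.atTop (nhds (Real.log ζr)) ∧
      Filter.Tendsto (deriv z) Filter.atBot (nhds 0) ∧
      Filter.Tendsto (deriv z) Filter.atTop (nhds 0) ∧
      ∀ ξ, Real.log ζl < z ξ ∧ z ξ < Real.log (K1 ^ 2 / ζl ^ 2) := by
  have hsq : Real.sqrt ζl ^ 2 = ζl := Real.sq_sqrt hζl.le
  have hsp : 0 < Real.sqrt ζl := Real.sqrt_pos.2 hζl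
  have hKpos : ζl * Real.sqrt ζl < -K1 := by
    have h1 : (wl / ζl + Real.sqrt ζl) * ζl < s * ζl := mul_lt_mul_of_pos_right hlax hζl
    rw [add_mul, div_mul_cancel₀ _ hζl.ne'] at h1
    rw [hK1]; linarith
  have hK1sq : ζl ^ 3 < K1 ^ 2 := by
    have h0 : 0 < ζl * Real.sqrt ζl := by positivity
    have : (ζl * Real.sqrt ζl) ^ 2 < (-K1) ^ 2 := by gcongr
    rw [mul_pow, hsq] at this
    linarith
  have hK1p : 0 < K1 ^ 2 := lt_trans (by positivity) hK1sq
  have hA : K2 - s * K1 = ζl ^ 2 / 2 + K1 ^ 2 / ζl := by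
    rw [hK2, hK1]; field_simp; ring
  set α : ℝ := ζl / 2 with hα
  set β : ℝ := K1 ^ 2 / ζl ^ 2 with hβ
  have hαβ : 2 * α < β := by
    rw [hα, hβ, lt_div_iff₀ (by positivity)]; linarith
  have hβ0 : 0 < β := by positivity
  have hexpz : ∀ x, Real.exp (Real.log ζl + x) = ζl * Real.exp x := fun x => by
    rw [Real.exp_add, Real.exp_log hζl]
  have hFG : ∀ x, F (Real.exp (Real.log ζl + x)) = twG α β x := by
    intro x
    rw [hF, hexpz, hA, twG, Real.exp_neg, show -2 * x = -(2 * x) by ring, Real.exp_neg,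
      show Real.exp (2 * x) = Real.exp x ^ 2 by rw [← Real.exp_nat_mul]; norm_num]
    have := Real.exp_pos x
    rw [hα, hβ]
    field_simp
  have hDe : Real.exp (Real.log β - Real.log ζl) = β / (2 * α) := by
    rw [Real.exp_sub, Real.exp_log hβ0, Real.exp_log hζl, hα]; congr 1; ring
  have hr : ∀ x, 0 < x → twG α β x = 0 → x = Real.log ζr - Real.log ζl := by
    intro x hx h0
    have hy1 : 1 < Real.exp x := Real.one_lt_exp_iff.2 hx
    rw [twG, Real.exp_neg, show -2 * x = -(2 * x) by ring, Real.exp_neg,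
      show Real.exp (2 * x) = Real.exp x ^ 2 by rw [← Real.exp_nat_mul]; norm_num] at h0
    have hxlog : Real.log (ζl * Real.exp x) = Real.log ζl + x := by
      rw [Real.log_mul hζl.ne' (Real.exp_pos x).ne', Real.log_exp]
    set y := Real.exp x
    have hy0 : 0 < y := by linarith
    have h1 : (y - 1) * (α * y ^ 2 + α * y - β) = 0 := by
      field_simp at h0
      linear_combination h0
    have h2 : α * y ^ 2 + α * y - β = 0 := by
      rcases mul_eq_zero.1 h1 with h | h
      · linarith
      · exact h
    have h3 : ζr = ζl * y := by
      have h4 : (8 * K1 ^ 2 + ζl ^ 3) / ζl = (2 * (ζl * y) + ζl) ^ 2 := by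
        rw [hα, hβ] at h2
        field_simp at h2 ⊢
        linear_combination -4 * h2
      rw [hζr, h4, Real.sqrt_sq (by positivity)]; ring
    rw [h3, hxlog]; ring
  obtain ⟨u, u', u'', hu, hu', heq, hb, l1, l2, l3, l4⟩ := tw_main (K1 ^ 2 / 3) c α β
    (Real.log β - Real.log ζl) (Real.log ζr - Real.log ζl) (by positivity) hc (by positivity) hαβ hDe hr
  have hz : ∀ ξ, HasDerivAt (fun ξ => Real.log ζl + u ξ) (u' ξ) ξ := fun ξ => (hu ξ).const_add _
  have hd1 : deriv (fun ξ => Real.log ζl + u ξ) = u' := funext fun ξ => (hz ξ).deriv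
  have hd2 : deriv u' = u'' := funext fun ξ => (hu' ξ).deriv
  have huc : Continuous u := continuous_iff_continuousAt.2 fun x => (hu x).continuousAt
  have huc' : Continuous u' := continuous_iff_continuousAt.2 fun x => (hu' x).continuousAt
  have huc'' : Continuous u'' := by
    have : u'' = fun ξ => -(c * u' ξ + twG α β (u ξ)) / (K1 ^ 2 / 3) := by
      funext ξ
      rw [eq_div_iff (by positivity)]
      linarith [heq ξ]
    rw [this]
    unfold twG
    fun_prop
  refine ⟨fun ξ => Real.log ζl + u ξ, ?_, ?_, ?_, ?_, ?_, ?_, ?_, ?_⟩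
  · rw [show (2 : WithTop ℕ∞) = 1 + 1 from rfl, contDiff_succ_iff_deriv]
    refine ⟨fun ξ => (hz ξ).differentiableAt, by simp, ?_⟩
    rw [hd1, contDiff_one_iff_deriv, hd2]
    exact ⟨fun ξ => (hu' ξ).differentiableAt, huc''⟩
  · by_contra hcon
    push Not at hcon
    have h1 : u = fun _ => u 0 := funext fun x => by have := hcon x 0; linarith
    rw [h1] at l1
    have := tendsto_nhds_unique l1 tendsto_const_nhds
    linarith [(hb 0).1]
  · intro ξ
    rw [hd1, hd2, hFG]; exact heq ξ
  · simpa using l1.const_add (Real.log ζl)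
  · simpa using l3.const_add (Real.log ζl)
  · rw [hd1]; exact l2
  · rw [hd1]; exact l4
  · intro ξ
    obtain ⟨h1, h2⟩ := hb ξ
    constructor <;> simp only [] <;> linarith
end

section
/- Suppose c > 0 satisfies c² < (4/3)·K₁²·F'(ζ_r)·ζ_r (the oscillatory, dispersion-dominated regime) and let z be a heteroclinic solution. Then z(ξ) > z_l for all ξ ∈ ℝ, and: (a) the supremum M₀ = sup_ξ z(ξ) is attained at a unique point χ₀, and z'(ξ) > 0 for all ξ < χ₀; (b) there exists ξ₀ < χ₀ such that (ξ − ξ₀)·z''(ξ) < 0 for all ξ < χ₀ with ξ ≠ ξ₀; (c) z has infinitely many local maxima and minima, attained at points χ₀ < χ₁ < χ₂ < … (strict local maxima) and ω₁ < ω₂ < … (strict local minima) with χ_i < ω_{i+1} < χ_{i+1} for all i ≥ 0, χ_i → ∞ and ω_i → ∞, and z_r < z(χ_{i+1}) < z(χ_i) and z(ω_i) < z(ω_{i+1}) < z_r for all i. -/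
open Filter Topology Set

lemma h_W {m c : ℝ} (hm : 0 < m) {v k : ℝ → ℝ} {t : ℝ}
    (hv : HasDerivAt v (-(c * v t + k t) / m) t) :
    HasDerivAt (fun t => Real.exp (c / m * t) * v t) (Real.exp (c / m * t) * (-(k t) / m)) t := by
  have h1 : HasDerivAt (fun t : ℝ => c / m * t) (c / m) t := by
    simpa using (hasDerivAt_id t).const_mul (c / m)
  refine (h1.exp.fun_mul hv).congr_deriv ?_
  field_simp
  ring

lemma h_first {v : ℝ → ℝ} (hv : Continuous v) {a r : ℝ} (ha : v a < 0) (hr : a < r)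
    (hvr : v r = 0) : ∃ b, a < b ∧ v b = 0 ∧ ∀ t, a ≤ t → t < b → v t < 0 := by
  have hc : IsCompact (Icc a r ∩ {t | v t = 0}) :=
    isCompact_Icc.inter_right (isClosed_eq hv continuous_const)
  obtain ⟨b, ⟨⟨hb1, hb2⟩, hb3⟩, hb⟩ := hc.exists_isLeast ⟨r, ⟨hr.le, le_refl r⟩, hvr⟩
  have hb3' : v b = 0 := hb3
  refine ⟨b, lt_of_le_of_ne hb1 ?_, hb3, ?_⟩
  · rintro rfl; linarith
  · intro t h1 h2
    by_contra hcon
    push Not at hcon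
    obtain ⟨x, hx, hx0⟩ := intermediate_value_Icc h1 hv.continuousOn ⟨ha.le, hcon⟩
    have := hb ⟨⟨hx.1, hx.2.trans (h2.le.trans hb2)⟩, hx0⟩
    linarith [hx.2]

lemma h_sign {v : ℝ → ℝ} {a d : ℝ} (hv : HasDerivAt v d a) (h0 : v a = 0) (hd : d < 0) :
    ∃ δ > 0, (∀ t, a < t → t < a + δ → v t < 0) ∧ (∀ t, a - δ < t → t < a → 0 < v t) := by
  have h := hasDerivAt_iff_tendsto_slope.1 hv
  have h2 : ∀ᶠ x in 𝓝[≠] a, slope v a x < 0 := h.eventually (gt_mem_nhds hd)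
  rw [eventually_nhdsWithin_iff, Metric.eventually_nhds_iff] at h2
  obtain ⟨δ, hδ, h2⟩ := h2
  refine ⟨δ, hδ, ?_, ?_⟩
  · intro t h3 h4
    have := h2 (y := t) (by rw [Real.dist_eq, abs_lt]; constructor <;> linarith) (by simpa using h3.ne')
    rw [slope_def_field, h0, sub_zero] at this
    have h5 : 0 < t - a := by linarith
    by_contra hc; push Not at hc
    have := div_nonneg hc h5.le
    linarith
  · intro t h3 h4
    have := h2 (y := t) (by rw [Real.dist_eq, abs_lt]; constructor <;> linarith) (by simpa using h4.ne)
    rw [slope_def_field, h0, sub_zero] at this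
    have h5 : t - a < 0 := by linarith
    by_contra hc; push Not at hc
    have := div_nonneg_of_nonpos hc h5.le
    linarith

lemma h_strictMono {f f' : ℝ → ℝ} (hf : ∀ t, HasDerivAt f (f' t) t) {D : Set ℝ} (hD : Convex ℝ D)
    (h : ∀ t ∈ interior D, 0 < f' t) : StrictMonoOn f D :=
  strictMonoOn_of_deriv_pos hD (fun t _ => (hf t).continuousAt.continuousWithinAt)
    (fun t ht => by rw [(hf t).deriv]; exact h t ht)

lemma h_strictAnti {f f' : ℝ → ℝ} (hf : ∀ t, HasDerivAt f (f' t) t) {D : Set ℝ} (hD : Convex ℝ D)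
    (h : ∀ t ∈ interior D, f' t < 0) : StrictAntiOn f D :=
  strictAntiOn_of_deriv_neg hD (fun t _ => (hf t).continuousAt.continuousWithinAt)
    (fun t ht => by rw [(hf t).deriv]; exact h t ht)

lemma h_locmax {z v : ℝ → ℝ} (hz : ∀ t, HasDerivAt z (v t) t) {a d : ℝ}
    (hv : HasDerivAt v d a) (h0 : v a = 0) (hd : d < 0) :
    ∃ δ > (0:ℝ), ∀ x, x ≠ a → |x - a| < δ → z x < z a := by
  obtain ⟨δ, hδ, h1, h2⟩ := h_sign hv h0 hd
  refine ⟨δ, hδ, fun x hx hxd => ?_⟩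
  rw [abs_lt] at hxd
  rcases lt_or_gt_of_ne hx with h | h
  · refine h_strictMono hz (convex_Icc x a) ?_ ⟨le_refl _, h.le⟩ ⟨h.le, le_refl _⟩ h
    intro t ht; rw [interior_Icc] at ht; exact h2 t (by linarith [ht.1]) ht.2
  · refine h_strictAnti hz (convex_Icc a x) ?_ ⟨le_refl _, h.le⟩ ⟨h.le, le_refl _⟩ h
    intro t ht; rw [interior_Icc] at ht; exact h1 t ht.1 (by linarith [ht.2])

lemma h_next {m c : ℝ} (hm : 0 < m) {y v k : ℝ → ℝ} (hy : ∀ t, HasDerivAt y (v t) t)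
    (hv : ∀ t, HasDerivAt v (-(c * v t + k t) / m) t) (hk : ∀ t, 0 < y t → 0 < k t)
    (hP : ∀ t, v t = 0 → y t ≠ 0) (hO : ∀ T, ∃ t, T < t ∧ y t = 0)
    {a : ℝ} (ha : v a = 0) (hya : 0 < y a) : ∃ b, a < b ∧ v b = 0 ∧ y b < 0 := by
  have hvc : Continuous v := continuous_iff_continuousAt.2 fun t => (hv t).continuousAt
  obtain ⟨δ, hδ, h1, -⟩ := h_sign (hv a) ha (by
    have := hk a hya
    rw [ha]; apply div_neg_of_neg_of_pos _ hm; linarith)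
  obtain ⟨t1, ht1, hy1⟩ := hO (a + δ / 2)
  obtain ⟨t2, ht2, hy2⟩ := hO t1
  obtain ⟨r, hr, hvr⟩ := exists_hasDerivAt_eq_zero ht2
    (fun t _ => (hy t).continuousAt.continuousWithinAt) (hy1.trans hy2.symm) (fun t _ => hy t)
  obtain ⟨b, hb, hvb, hneg⟩ := h_first hvc (h1 (a + δ / 2) (by linarith) (by linarith))
    (by linarith [hr.1] : a + δ / 2 < r) hvr
  have hneg' : ∀ t ∈ Ioo a b, v t < 0 := by
    intro t ht
    rcases lt_or_ge t (a + δ / 2) with h | h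
    · exact h1 t ht.1 (by linarith)
    · exact hneg t h ht.2
  have hab : a < b := by linarith
  refine ⟨b, hab, hvb, ?_⟩
  by_contra hcon
  have hyb : 0 < y b := lt_of_le_of_ne (not_lt.1 hcon) (hP b hvb).symm
  have hanti : StrictAntiOn y (Icc a b) := h_strictAnti hy (convex_Icc a b)
    (by rw [interior_Icc]; exact hneg')
  have hW := h_strictAnti (fun t => h_W hm (hv t)) (convex_Icc a b) (by
    rw [interior_Icc]; intro t ht
    have h3 : y b < y t := hanti ⟨ht.1.le, ht.2.le⟩ ⟨hab.le, le_refl _⟩ ht.2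
    have h4 := hk t (hyb.trans h3)
    exact mul_neg_of_pos_of_neg (Real.exp_pos _) (div_neg_of_neg_of_pos (by linarith) hm))
  have := hW ⟨le_refl _, hab.le⟩ ⟨hab.le, le_refl _⟩ hab
  simp [ha, hvb] at this

/-- Oscillation. -/
lemma h_osc {m c κ : ℝ} (hm : 0 < m) (hκ : c ^ 2 < 4 * m * κ) {y v h : ℝ → ℝ}
    (hy : ∀ t, HasDerivAt y (v t) t)
    (hv : ∀ t, HasDerivAt v (-(c * v t + h t * y t) / m) t)
    (hh : Tendsto h atTop (𝓝 κ)) (T : ℝ) : ∃ t, T < t ∧ y t = 0 := by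
  by_contra hcon
  push Not at hcon
  obtain ⟨κ', hκ1, hκ2⟩ : ∃ κ', c ^ 2 / (4 * m) < κ' ∧ κ' < κ :=
    exists_between (by rw [div_lt_iff₀ (by positivity)]; linarith)
  rw [div_lt_iff₀ (by positivity)] at hκ1
  have hev : ∀ᶠ t in atTop, κ' < h t := hh.eventually (lt_mem_nhds hκ2)
  obtain ⟨T1, hT1⟩ := (hev.and (eventually_gt_atTop T)).exists_forall_of_atTop
  -- quadratic bound
  obtain ⟨ε, hε, hq⟩ : ∃ ε > 0, ∀ w : ℝ, ε * (1 + w ^ 2) ≤ w ^ 2 + c * w / m + κ' / m := by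
    set k := κ' / m with hk
    set b := c / m with hb
    have hbk : b ^ 2 < 4 * k := by
      rw [hb, hk, div_pow, div_lt_iff₀ (by positivity)]
      calc c ^ 2 < κ' * (4 * m) := hκ1
        _ = 4 * (κ' / m) * m ^ 2 := by field_simp
    have hk0 : 0 < k := by nlinarith [sq_nonneg b]
    refine ⟨(k - b ^ 2 / 4) / (1 + k), div_pos (by linarith) (by linarith), fun w => ?_⟩
    set ε := (k - b ^ 2 / 4) / (1 + k) with hε
    have he : ε * (1 + k) = k - b ^ 2 / 4 := by rw [hε]; field_simp
    have he1 : ε < 1 := by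
      rw [hε, div_lt_one (by linarith)]; nlinarith [sq_nonneg b]
    have e1 : c * w / m = b * w := by rw [hb]; ring
    rw [e1]
    have h4 : 0 ≤ (1 - ε) * (w ^ 2 + b * w + k - ε * (1 + w ^ 2)) := by
      nlinarith [sq_nonneg (2 * (1 - ε) * w + b), sq_nonneg ε]
    have := nonneg_of_mul_nonneg_right h4 (by linarith)
    linarith
  have hd : ∀ t, T1 ≤ t → HasDerivAt (fun t => Real.arctan (v t / y t) + ε * t)
      (1 / (1 + (v t / y t) ^ 2) * ((-(c * v t + h t * y t) / m * y t - v t * v t) / y t ^ 2) + ε) t := by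
    intro t ht
    have hyt := hcon t (hT1 t ht).2
    have h2 : HasDerivAt (fun t : ℝ => ε * t) ε t := by
      simpa using (hasDerivAt_id t).const_mul ε
    exact ((hv t).fun_div (hy t) hyt).arctan.fun_add h2
  have hanti : AntitoneOn (fun t => Real.arctan (v t / y t) + ε * t) (Ici T1) := by
    apply antitoneOn_of_deriv_nonpos (convex_Ici _)
    · intro t ht; exact (hd t ht).continuousAt.continuousWithinAt
    · intro t ht; rw [interior_Ici] at ht
      exact (hd t (le_of_lt ht)).differentiableAt.differentiableWithinAt
    · intro t ht; rw [interior_Ici] at ht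
      have ht' : T1 ≤ t := le_of_lt ht
      rw [(hd t ht').deriv]
      have hyt := hcon t (hT1 t ht').2
      have hht := (hT1 t ht').1
      have e : (-(c * v t + h t * y t) / m * y t - v t * v t) / y t ^ 2
          = -((v t / y t) ^ 2 + c * (v t / y t) / m + h t / m) := by
        field_simp; ring
      rw [e]
      have h1 := hq (v t / y t)
      have h2 : κ' / m ≤ h t / m := by gcongr
      have h3 : 0 < 1 + (v t / y t) ^ 2 := by positivity
      have h4 : 1 / (1 + (v t / y t) ^ 2) * -((v t / y t) ^ 2 + c * (v t / y t) / m + h t / m) ≤ -ε := by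
        rw [one_div, inv_mul_le_iff₀ h3]; linarith
      linarith
  have h1 := hanti (mem_Ici.2 (le_refl T1)) (mem_Ici.2 (by
    have : 0 < 4 / ε := by positivity
    linarith : T1 ≤ T1 + 4 / ε)) (by
    have : 0 < 4 / ε := by positivity
    linarith : T1 ≤ T1 + 4 / ε)
  have e : ε * (T1 + 4 / ε) = ε * T1 + 4 := by field_simp
  simp only [e] at h1
  have := Real.arctan_lt_pi_div_two (v T1 / y T1)
  have := Real.neg_pi_div_two_lt_arctan (v (T1 + 4/ε) / y (T1 + 4/ε))
  linarith [Real.pi_lt_four]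

/-- Uniqueness at equilibria. -/
lemma h_uniq {m c : ℝ} (hm : 0 < m) {y v h : ℝ → ℝ}
    (hy : ∀ t, HasDerivAt y (v t) t)
    (hv : ∀ t, HasDerivAt v (-(c * v t + h t * y t) / m) t)
    (hh : Continuous h) {a : ℝ} (h0 : y a = 0) (h1 : v a = 0) (b : ℝ) : y b = 0 := by
  obtain ⟨B, hB⟩ := (isCompact_Icc (a := min a b) (b := max a b)).exists_bound_of_continuousOn
    hh.continuousOn
  set N : ℝ → ℝ := fun t => y t ^ 2 + v t ^ 2 with hN
  set N' : ℝ → ℝ := fun t => 2 * y t * v t + 2 * v t * (-(c * v t + h t * y t) / m) with hN'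
  have hd : ∀ t, HasDerivAt N (N' t) t := by
    intro t
    refine (((hy t).fun_pow 2).fun_add ((hv t).fun_pow 2)).congr_deriv ?_
    simp [hN']
  set K := 1 + 2 * |c| / m + B / m with hK
  have hbd : ∀ t ∈ Icc (min a b) (max a b), |N' t| ≤ K * N t := by
    intro t ht
    have hBt := hB t ht
    rw [Real.norm_eq_abs] at hBt
    have hB0 : 0 ≤ B := (abs_nonneg _).trans hBt
    have e : N' t = 2 * (y t * v t) - 2 * (c / m) * v t ^ 2 - (h t / m) * (2 * (y t * v t)) := by
      simp only [hN']; field_simp; ring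
    have h2 : |2 * (y t * v t)| ≤ N t := by
      rw [abs_le]; simp only [hN]
      constructor <;> nlinarith [sq_nonneg (y t + v t), sq_nonneg (y t - v t)]
    have h3 : v t ^ 2 ≤ N t := by simp only [hN]; nlinarith [sq_nonneg (y t)]
    have hN0 : 0 ≤ N t := by simp only [hN]; positivity
    rw [e]
    calc _ ≤ |2 * (y t * v t)| + |2 * (c / m) * v t ^ 2| + |(h t / m) * (2 * (y t * v t))| := by
          refine (abs_sub _ _).trans ?_
          gcongr
          exact abs_sub _ _
      _ = |2 * (y t * v t)| + 2 * |c| / m * v t ^ 2 + |h t| / m * |2 * (y t * v t)| := by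
          rw [abs_mul (2 * (c / m)), abs_mul (h t / m), abs_mul 2 (c / m), abs_div c, abs_div (h t),
            abs_of_pos hm, abs_of_nonneg (sq_nonneg (v t))]
          rw [abs_of_pos (two_pos : (0:ℝ) < 2)]; ring
      _ ≤ N t + 2 * |c| / m * N t + B / m * N t := by gcongr
      _ = K * N t := by rw [hK]; ring
  have hexp : ∀ L t : ℝ, HasDerivAt (fun t => Real.exp (L * t) * N t)
      (Real.exp (L * t) * (L * N t + N' t)) t := by
    intro L t
    have h1 : HasDerivAt (fun t : ℝ => L * t) L t := by
      simpa using (hasDerivAt_id t).const_mul L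
    refine (h1.exp.fun_mul (hd t)).congr_deriv ?_
    ring
  have hNa : N a = 0 := by simp [hN, h0, h1]
  have key : N b ≤ 0 := by
    rcases le_total a b with hab | hab
    · have : AntitoneOn (fun t => Real.exp (-K * t) * N t) (Icc a b) := by
        apply antitoneOn_of_deriv_nonpos (convex_Icc _ _)
        · intro t ht; exact (hexp _ t).continuousAt.continuousWithinAt
        · intro t ht; exact (hexp _ t).differentiableAt.differentiableWithinAt
        · intro t ht; rw [(hexp _ t).deriv]
          have := hbd t (by rw [min_eq_left hab, max_eq_right hab]; exact interior_subset ht)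
          apply mul_nonpos_of_nonneg_of_nonpos (Real.exp_pos _).le
          linarith [(abs_le.1 this).2]
      have := this ⟨le_refl _, hab⟩ ⟨hab, le_refl _⟩ hab
      simp only [hNa, mul_zero] at this
      by_contra hc; push Not at hc
      have := mul_pos (Real.exp_pos (-K * b)) hc
      linarith
    · have : MonotoneOn (fun t => Real.exp (K * t) * N t) (Icc b a) := by
        apply monotoneOn_of_deriv_nonneg (convex_Icc _ _)
        · intro t ht; exact (hexp _ t).continuousAt.continuousWithinAt
        · intro t ht; exact (hexp _ t).differentiableAt.differentiableWithinAt
        · intro t ht; rw [(hexp _ t).deriv]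
          have := hbd t (by rw [min_eq_right hab, max_eq_left hab]; exact interior_subset ht)
          apply mul_nonneg (Real.exp_pos _).le
          linarith [(abs_le.1 this).1]
      have := this ⟨le_refl _, hab⟩ ⟨hab, le_refl _⟩ hab
      simp only [hNa, mul_zero] at this
      by_contra hc; push Not at hc
      have := mul_pos (Real.exp_pos (K * b)) hc
      linarith
  simp only [hN] at key
  nlinarith [sq_nonneg (y b), sq_nonneg (v b)]

lemma h_dslope_cont {g g' : ℝ → ℝ} (hg : ∀ x, HasDerivAt g (g' x) x) (e : ℝ) :
    Continuous (dslope g e) := by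
  rw [continuous_iff_continuousAt]
  intro x
  by_cases hx : x = e
  · rw [hx]; exact continuousAt_dslope_same.2 (hg e).differentiableAt
  · exact (continuousAt_dslope_of_ne hx).2 (hg x).continuousAt

lemma h_seq {z v : ℝ → ℝ} {zr : ℝ} (hzc : Continuous z) (hvc : Continuous v)
    (hP : ∀ t, v t = 0 → z t ≠ zr)
    (hdown : ∀ a, v a = 0 → zr < z a → ∃ b, a < b ∧ v b = 0 ∧ z b < zr)
    (hup : ∀ a, v a = 0 → z a < zr → ∃ b, a < b ∧ v b = 0 ∧ zr < z b)
    {a : ℝ} (ha : v a = 0) (hza : zr < z a) :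
    ∃ χ ω : ℕ → ℝ, χ 0 = a ∧ (∀ i, χ i < ω i ∧ ω i < χ (i + 1)) ∧
      (∀ i, v (χ i) = 0 ∧ zr < z (χ i)) ∧ (∀ i, v (ω i) = 0 ∧ z (ω i) < zr) ∧
      Tendsto χ atTop atTop ∧ Tendsto ω atTop atTop := by
  choose! f hf1 hf2 hf3 using hdown
  choose! k hk1 hk2 hk3 using hup
  set χ : ℕ → ℝ := fun i => (fun t => k (f t))^[i] a with hχ
  have hs : ∀ i, χ (i + 1) = k (f (χ i)) := fun i => by
    simp only [hχ, Function.iterate_succ_apply']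
  have hχP : ∀ i, v (χ i) = 0 ∧ zr < z (χ i) := by
    intro i
    induction i with
    | zero => exact ⟨ha, hza⟩
    | succ i ih =>
      rw [hs]
      have h1 := hf2 _ ih.1 ih.2
      have h2 := hf3 _ ih.1 ih.2
      exact ⟨hk2 _ h1 h2, hk3 _ h1 h2⟩
  have hωP : ∀ i, v (f (χ i)) = 0 ∧ z (f (χ i)) < zr := fun i =>
    ⟨hf2 _ (hχP i).1 (hχP i).2, hf3 _ (hχP i).1 (hχP i).2⟩
  have hlace : ∀ i, χ i < f (χ i) ∧ f (χ i) < χ (i + 1) := fun i =>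
    ⟨hf1 _ (hχP i).1 (hχP i).2, by rw [hs]; exact hk1 _ (hωP i).1 (hωP i).2⟩
  have hmono : StrictMono χ := strictMono_nat_of_lt_succ fun i => (hlace i).1.trans (hlace i).2
  have hχT : Tendsto χ atTop atTop := by
    rcases tendsto_atTop_of_monotone hmono.monotone with h | ⟨l, hl⟩
    · exact h
    · exfalso
      have hl1 : Tendsto (fun i => χ (i + 1)) atTop (𝓝 l) := hl.comp (tendsto_add_atTop_nat 1)
      have hω : Tendsto (fun i => f (χ i)) atTop (𝓝 l) :=
        tendsto_of_tendsto_of_tendsto_of_le_of_le hl hl1 (fun i => (hlace i).1.le)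
          (fun i => (hlace i).2.le)
      have e1 : zr ≤ z l := ge_of_tendsto' ((hzc.tendsto l).comp hl) fun i => (hχP i).2.le
      have e2 : z l ≤ zr := le_of_tendsto' ((hzc.tendsto l).comp hω) fun i => (hωP i).2.le
      have e3 : v l = 0 := by
        refine tendsto_nhds_unique ((hvc.tendsto l).comp hl) ?_
        have : v ∘ χ = fun _ => 0 := funext fun i => (hχP i).1
        rw [this]; exact tendsto_const_nhds
      exact hP l e3 (le_antisymm e2 e1)
  exact ⟨χ, fun i => f (χ i), rfl, hlace, hχP, hωP, hχT,
    tendsto_atTop_mono (fun i => (hlace i).1.le) hχT⟩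

theorem h_main {m c zl zr zs : ℝ} (hm : 0 < m) (hc : 0 < c) {g g' G z v : ℝ → ℝ}
    (hG : ∀ x, HasDerivAt G (g x) x) (hg : ∀ x, HasDerivAt g (g' x) x)
    (hlr : zl < zr) (hgl : g zl = 0) (hgr : g zr = 0)
    (hneg : ∀ x, zl < x → x < zr → g x < 0) (hpos : ∀ x, zr < x → 0 < g x)
    (hg1 : ∀ x, x < zs → g' x < 0) (hg2 : ∀ x, zs < x → 0 < g' x)
    (hosc : c ^ 2 < 4 * m * g' zr)
    (hz : ∀ t, HasDerivAt z (v t) t) (hv : ∀ t, HasDerivAt v (-(c * v t + g (z t)) / m) t)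
    (hlim1 : Tendsto z atBot (𝓝 zl)) (hlim2 : Tendsto z atTop (𝓝 zr))
    (hlim3 : Tendsto v atBot (𝓝 0)) :
    (∀ ξ, zl < z ξ) ∧
    ∃ χ ω : ℕ → ℝ,
      (∀ ξ, z ξ ≤ z (χ 0)) ∧
      (∀ ξ, ξ ≠ χ 0 → z ξ < z (χ 0)) ∧
      (∀ ξ, ξ < χ 0 → 0 < v ξ) ∧
      (∃ ξ₀, ξ₀ < χ 0 ∧
        ∀ ξ, ξ < χ 0 → ξ ≠ ξ₀ → (ξ - ξ₀) * (-(c * v ξ + g (z ξ)) / m) < 0) ∧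
      (∀ i, χ i < ω i ∧ ω i < χ (i + 1)) ∧
      (∀ i, ∃ δ > (0:ℝ), ∀ x, x ≠ χ i → |x - χ i| < δ → z x < z (χ i)) ∧
      (∀ i, ∃ δ > (0:ℝ), ∀ x, x ≠ ω i → |x - ω i| < δ → z (ω i) < z x) ∧
      Filter.Tendsto χ Filter.atTop Filter.atTop ∧
      Filter.Tendsto ω Filter.atTop Filter.atTop ∧
      (∀ i, zr < z (χ (i + 1)) ∧ z (χ (i + 1)) < z (χ i)) ∧
      (∀ i, z (ω i) < z (ω (i + 1)) ∧ z (ω (i + 1)) < zr) := by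
  have hzc : Continuous z := continuous_iff_continuousAt.2 fun t => (hz t).continuousAt
  have hvc : Continuous v := continuous_iff_continuousAt.2 fun t => (hv t).continuousAt
  -- no equilibrium is reached
  have hvd : ∀ e, g e = 0 → ∀ t, HasDerivAt v (-(c * v t + dslope g e (z t) * (z t - e)) / m) t := by
    intro e he t
    have h1 := sub_smul_dslope g e (z t)
    rw [he, sub_zero, smul_eq_mul, mul_comm] at h1
    rw [h1]; exact hv t
  have hP : ∀ t, v t = 0 → g (z t) ≠ 0 := by
    intro a ha hga
    have hconst : ∀ b, z b = z a := fun b => by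
      have := h_uniq (y := fun t => z t - z a) (h := fun t => dslope g (z a) (z t)) hm
        (fun t => (hz t).sub_const (z a)) (hvd (z a) hga)
        ((h_dslope_cont hg (z a)).comp hzc) (a := a) (sub_self _) ha b
      linarith
    have h1 : z = fun _ => z a := funext hconst
    rw [h1] at hlim1 hlim2
    have := tendsto_nhds_unique hlim1 tendsto_const_nhds
    have := tendsto_nhds_unique hlim2 tendsto_const_nhds
    linarith
  -- energy
  set E : ℝ → ℝ := fun t => m / 2 * v t ^ 2 + G (z t) with hE
  have hEd : ∀ t, HasDerivAt E (-(c * v t ^ 2)) t := by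
    intro t
    refine ((((hv t).fun_pow 2).const_mul (m / 2)).fun_add ((hG (z t)).comp t (hz t))).congr_deriv ?_
    simp only [Nat.cast_ofNat]
    field_simp
    ring
  have hEa : Antitone E := antitone_of_deriv_nonpos (fun t => (hEd t).differentiableAt)
    fun t => by rw [(hEd t).deriv]; have := sq_nonneg (v t); nlinarith
  have hEs : StrictAnti E := by
    intro a b hab
    refine lt_of_le_of_ne (hEa hab.le) fun heq => ?_
    have hconst : ∀ t ∈ Ioo a b, E t = E a := fun t ht =>
      le_antisymm (hEa ht.1.le) (heq ▸ hEa ht.2.le)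
    have hv0 : ∀ t ∈ Ioo a b, v t = 0 := by
      intro t ht
      have h1 : HasDerivAt E 0 t := (hasDerivAt_const t (E a)).congr_of_eventuallyEq (by
        filter_upwards [Ioo_mem_nhds ht.1 ht.2] with s hs using hconst s hs)
      have h2 := (hEd t).unique h1
      have h3 : v t ^ 2 = 0 := by
        have : c * v t ^ 2 = 0 := by linarith
        exact (mul_eq_zero.1 this).resolve_left hc.ne'
      exact pow_eq_zero_iff (two_ne_zero) |>.1 h3
    have hmid : (a + b) / 2 ∈ Ioo a b := ⟨by linarith, by linarith⟩
    have h1 : HasDerivAt v 0 ((a + b) / 2) :=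
      (hasDerivAt_const _ (0:ℝ)).congr_of_eventuallyEq (by
        filter_upwards [Ioo_mem_nhds hmid.1 hmid.2] with s hs using hv0 s hs)
    have h2 := (hv _).unique h1
    rw [hv0 _ hmid] at h2
    have h3 := (div_eq_zero_iff.1 h2).resolve_right hm.ne'
    exact hP _ (hv0 _ hmid) (by linarith)
  have hElim : Tendsto E atBot (𝓝 (G zl)) := by
    have h1 : Tendsto (fun t => m / 2 * v t ^ 2 + G (z t)) atBot (𝓝 (m / 2 * 0 ^ 2 + G zl)) :=
      ((hlim3.pow 2).const_mul _).add ((hG zl).continuousAt.tendsto.comp hlim1)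
    simpa using h1
  have hElt : ∀ t, E t < G zl := fun t =>
    (hEs (by linarith : t - 1 < t)).trans_le (hEa.ge_of_tendsto hElim _)
  have hGE : ∀ t, G (z t) ≤ E t := fun t => by
    simp only [hE]; nlinarith [sq_nonneg (v t)]
  -- positivity
  have hzl : ∀ t, zl < z t := by
    intro t
    by_contra hcon
    push Not at hcon
    obtain ⟨s, hs⟩ := (hlim2.eventually (lt_mem_nhds hlr)).exists
    obtain ⟨x, hx⟩ := mem_range_of_exists_le_of_exists_ge hzc ⟨t, hcon⟩ ⟨s, hs.le⟩
    have := hGE x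
    have := hElt x
    rw [hx] at *
    linarith
  -- G monotonicity
  have hGup : StrictMonoOn G (Ici zr) := h_strictMono hG (convex_Ici _) (by
    rw [interior_Ici]; exact fun x hx => hpos x hx)
  have hGdn : StrictAntiOn G (Icc zl zr) := h_strictAnti hG (convex_Icc _ _) (by
    rw [interior_Icc]; exact fun x hx => hneg x hx.1 hx.2)
  -- oscillation
  have hO : ∀ T, ∃ t, T < t ∧ z t = zr := by
    intro T
    obtain ⟨t, h1, h2⟩ := h_osc (y := fun t => z t - zr) (h := fun t => dslope g zr (z t)) hm hosc
      (fun t => (hz t).sub_const zr) (hvd zr hgr) (by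
        have := ((h_dslope_cont hg zr).tendsto zr).comp hlim2
        rwa [dslope_same, (hg zr).deriv] at this) T
    exact ⟨t, h1, by linarith⟩
  have hP' : ∀ t, v t = 0 → z t ≠ zr := fun t h1 h2 => hP t h1 (by rw [h2, hgr])
  have hdown : ∀ a, v a = 0 → zr < z a → ∃ b, a < b ∧ v b = 0 ∧ z b < zr := by
    intro a ha hza
    obtain ⟨b, h1, h2, h3⟩ := h_next (y := fun t => z t - zr) (k := fun t => g (z t)) hm
      (fun t => (hz t).sub_const zr) hv (fun t ht => hpos _ (by linarith))
      (fun t ht => sub_ne_zero.2 (hP' t ht))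
      (fun T => (hO T).imp fun t ht => ⟨ht.1, by simp [ht.2]⟩) ha (by linarith)
    exact ⟨b, h1, h2, by linarith⟩
  have hup : ∀ a, v a = 0 → z a < zr → ∃ b, a < b ∧ v b = 0 ∧ zr < z b := by
    intro a ha hza
    obtain ⟨b, h1, h2, h3⟩ := h_next (c := c) (y := fun t => zr - z t) (v := fun t => - v t)
      (k := fun t => - g (z t)) hm
      (fun t => (hz t).const_sub zr) (fun t => (hv t).fun_neg.congr_deriv (by ring))
      (fun t ht => by have := hneg _ (hzl t) (by linarith); linarith)
      (fun t ht => sub_ne_zero.2 (hP' t (neg_eq_zero.1 ht)).symm)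
      (fun T => (hO T).imp fun t ht => ⟨ht.1, by simp [ht.2]⟩) (a := a) (by simp [ha]) (by linarith)
    exact ⟨b, h1, neg_eq_zero.1 h2, by linarith⟩
  -- behaviour at the left
  have hinit : ∀ t, (∀ s, s < t → z s < zr) → 0 < v t := by
    intro t ht
    by_contra hcon
    push Not at hcon
    have hW := h_strictMono (fun t => h_W (k := fun t => g (z t)) hm (hv t)) (convex_Iic t) (by
      rw [interior_Iic]; intro s hs
      have := hneg _ (hzl s) (ht s hs)
      exact mul_pos (Real.exp_pos _) (div_pos (by linarith) hm))
    have hvn : ∀ s, s < t → v s < 0 := by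
      intro s hs
      have h1 := hW (mem_Iic.2 hs.le) (mem_Iic.2 le_rfl) hs
      simp only at h1
      have h2 : Real.exp (c / m * t) * v t ≤ 0 :=
        mul_nonpos_of_nonneg_of_nonpos (Real.exp_pos _).le hcon
      by_contra h3; push Not at h3
      have := mul_nonneg (Real.exp_pos (c / m * s)).le h3
      linarith
    have hza := h_strictAnti hz (convex_Iic t) (by rw [interior_Iic]; exact fun s hs => hvn s hs)
    have : z t ≤ zl := by
      refine ge_of_tendsto hlim1 ?_
      filter_upwards [eventually_lt_atBot t] with s hs
      exact (hza (mem_Iic.2 hs.le) (mem_Iic.2 le_rfl) hs).le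
    linarith [hzl t]
  obtain ⟨T, hT⟩ := (hlim1.eventually (gt_mem_nhds hlr)).exists_forall_of_atBot
  have hTv : ∀ t, t ≤ T → 0 < v t := fun t ht => hinit t fun s hs => hT s (hs.le.trans ht)
  obtain ⟨r, hr, hvr⟩ : ∃ r, T < r ∧ v r = 0 := by
    obtain ⟨t1, ht1, h1⟩ := hO T
    obtain ⟨t2, ht2, h2⟩ := hO t1
    obtain ⟨r, hr, h⟩ := exists_hasDerivAt_eq_zero ht2 hzc.continuousOn (h1.trans h2.symm)
      (fun t _ => hz t)
    exact ⟨r, ht1.trans hr.1, h⟩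
  obtain ⟨x0, hx0, hvx0, hx0n⟩ := h_first (v := fun t => - v t) hvc.neg (a := T) (r := r)
    (by linarith [hTv T le_rfl]) hr (by simp [hvr])
  have hvx0 : v x0 = 0 := neg_eq_zero.1 hvx0
  have hvpos : ∀ t, t < x0 → 0 < v t := by
    intro t ht
    rcases le_total t T with h | h
    · exact hTv t h
    · linarith [hx0n t h ht]
  have hzmono : StrictMonoOn z (Iic x0) := h_strictMono hz (convex_Iic _) (by
    rw [interior_Iic]; exact fun t ht => hvpos t ht)
  have hzx0 : zr < z x0 := by
    by_contra hcon
    push Not at hcon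
    have := hinit x0 fun s hs => (hzmono (mem_Iic.2 hs.le) (mem_Iic.2 le_rfl) hs).trans_le hcon
    linarith
  have hmaxpt : ∀ a, v a = 0 → zr < z a → ∀ t, a < t → z t < z a := by
    intro a ha hza t hat
    by_contra hcon
    push Not at hcon
    have h1 := hEs hat
    have h2 : E a = G (z a) := by simp [hE, ha]
    have h3 := hGup.monotoneOn (mem_Ici.2 hza.le) (mem_Ici.2 (hza.le.trans hcon)) hcon
    linarith [hGE t]
  have hminpt : ∀ a, v a = 0 → z a < zr → ∀ t, a < t → z a < z t := by
    intro a ha hza t hat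
    by_contra hcon
    push Not at hcon
    have h1 := hEs hat
    have h2 : E a = G (z a) := by simp [hE, ha]
    have h3 := hGdn.antitoneOn ⟨(hzl t).le, hcon.trans hza.le⟩ ⟨(hzl a).le, hza.le⟩ hcon
    linarith [hGE t]
  have hstrict : ∀ ξ, ξ ≠ x0 → z ξ < z x0 := by
    intro ξ hξ
    rcases lt_or_gt_of_ne hξ with h | h
    · exact hzmono (mem_Iic.2 h.le) (mem_Iic.2 le_rfl) h
    · exact hmaxpt x0 hvx0 hzx0 ξ h
  -- inflection point
  have hinfl : ∃ ξ₀, ξ₀ < x0 ∧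
        ∀ ξ, ξ < x0 → ξ ≠ ξ₀ → (ξ - ξ₀) * (-(c * v ξ + g (z ξ)) / m) < 0 := by
    set u : ℝ → ℝ := fun t => -(c * v t + g (z t)) / m with hu
    have hud : ∀ t, HasDerivAt u (-(c * u t + g' (z t) * v t) / m) t := by
      intro t
      exact ((((hv t).const_mul c).fun_add ((hg (z t)).comp t (hz t))).fun_neg).div_const m
    have huc : Continuous u := continuous_iff_continuousAt.2 fun t => (hud t).continuousAt
    set U : ℝ → ℝ := fun t => Real.exp (c / m * t) * u t with hU
    have hUd := fun t => h_W (k := fun t => g' (z t) * v t) hm (hud t)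
    have hUc : Continuous U := continuous_iff_continuousAt.2 fun t => (hUd t).continuousAt
    obtain ⟨e, he, hge⟩ := exists_hasDerivAt_eq_zero hlr
      (fun t _ => (hg t).continuousAt.continuousWithinAt) (hgl.trans hgr.symm) (fun t _ => hg t)
    have hes : e = zs := by
      rcases lt_trichotomy e zs with h | h | h
      · linarith [hg1 e h]
      · exact h
      · linarith [hg2 e h]
    rw [hes] at he
    obtain ⟨p, hp, hpx⟩ := ((hlim1.eventually (gt_mem_nhds he.1)).and (eventually_lt_atBot x0)).exists
    obtain ⟨xs, hxs, hzxs⟩ := intermediate_value_Icc hpx.le hzc.continuousOn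
      ⟨hp.le, (he.2.trans hzx0).le⟩
    have hxs0 : xs < x0 := lt_of_le_of_ne hxs.2 (by rintro rfl; linarith [he.2])
    have hUmono : StrictMonoOn U (Iic xs) := h_strictMono hUd (convex_Iic _) (by
      rw [interior_Iic]; intro t ht
      have ht' : t < xs := ht
      have h1 : z t < zs := hzxs ▸ hzmono (mem_Iic.2 (ht'.trans hxs0).le) (mem_Iic.2 hxs0.le) ht'
      have h2 := hvpos t (ht'.trans hxs0)
      have h3 := mul_neg_of_neg_of_pos (hg1 _ h1) h2
      exact mul_pos (Real.exp_pos _) (div_pos (by linarith) hm))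
    have hUanti : StrictAntiOn U (Icc xs x0) := h_strictAnti hUd (convex_Icc _ _) (by
      rw [interior_Icc]; intro t ht
      have h1 : zs < z t := hzxs ▸ hzmono (mem_Iic.2 hxs0.le) (mem_Iic.2 ht.2.le) ht.1
      have h2 := hvpos t ht.2
      have h3 := mul_pos (hg2 _ h1) h2
      exact mul_neg_of_pos_of_neg (Real.exp_pos _) (div_neg_of_neg_of_pos (by linarith) hm))
    have hsgn1 : ∀ t, U t < 0 → u t < 0 := fun t ht => by
      by_contra h; push Not at h
      have := mul_nonneg (Real.exp_pos (c / m * t)).le h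
      simp only [hU] at ht; linarith
    have hsgn2 : ∀ t, 0 < U t → 0 < u t := fun t ht => by
      by_contra h; push Not at h
      have := mul_nonpos_of_nonneg_of_nonpos (Real.exp_pos (c / m * t)).le h
      simp only [hU] at ht; linarith
    have hUpos : ∀ t, t ≤ xs → 0 < U t := by
      intro t ht
      by_contra hcon
      push Not at hcon
      have hun : ∀ s, s < t → u s < 0 := fun s hs =>
        hsgn1 s ((hUmono (mem_Iic.2 (hs.le.trans ht)) (mem_Iic.2 ht) hs).trans_le hcon)
      have hva := h_strictAnti hv (convex_Iic t) (by rw [interior_Iic]; exact fun s hs => hun s hs)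
      have : v t ≤ 0 := by
        refine ge_of_tendsto hlim3 ?_
        filter_upwards [eventually_lt_atBot t] with s hs
        exact (hva (mem_Iic.2 hs.le) (mem_Iic.2 le_rfl) hs).le
      linarith [hvpos t (ht.trans_lt hxs0)]
    have hUx0 : U x0 < 0 := by
      have : u x0 < 0 := by
        simp only [hu, hvx0]
        exact div_neg_of_neg_of_pos (by linarith [hpos _ hzx0]) hm
      exact mul_neg_of_pos_of_neg (Real.exp_pos _) this
    obtain ⟨ξ₀, hξ, hξ0⟩ := intermediate_value_Icc' hxs0.le hUc.continuousOn
      ⟨hUx0.le, (hUpos xs le_rfl).le⟩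
    have hξx : ξ₀ < x0 := lt_of_le_of_ne hξ.2 (by rintro rfl; linarith)
    refine ⟨ξ₀, hξx, fun ξ h1 h2 => ?_⟩
    rcases lt_or_gt_of_ne h2 with h | h
    · refine mul_neg_of_neg_of_pos (by linarith) (hsgn2 ξ ?_)
      rcases le_total ξ xs with h3 | h3
      · exact hUpos ξ h3
      · have := hUanti ⟨h3, h1.le⟩ hξ h
        linarith
    · refine mul_neg_of_pos_of_neg (by linarith) (hsgn1 ξ ?_)
      have := hUanti hξ ⟨hξ.1.trans h.le, h1.le⟩ h
      linarith
  obtain ⟨χ, ω, h0, hlace, hχ, hω, hT1, hT2⟩ := h_seq hzc hvc hP' hdown hup hvx0 hzx0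
  refine ⟨hzl, χ, ω, ?_, ?_, ?_, ?_, hlace, ?_, ?_, hT1, hT2, ?_, ?_⟩
  · rw [h0]; intro ξ
    by_cases h : ξ = x0
    · rw [h]
    · exact (hstrict ξ h).le
  · rw [h0]; exact hstrict
  · rw [h0]; exact hvpos
  · rw [h0]; exact hinfl
  · intro i
    refine h_locmax hz (hv _) (hχ i).1 ?_
    rw [(hχ i).1]
    exact div_neg_of_neg_of_pos (by linarith [hpos _ (hχ i).2]) hm
  · intro i
    obtain ⟨δ, hδ, h⟩ := h_locmax (fun t => (hz t).fun_neg) (hv _).fun_neg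
      (neg_eq_zero.2 (hω i).1) (by
        rw [(hω i).1]
        have := div_pos (neg_pos.2 (hneg _ (hzl _) (hω i).2)) hm
        have e : (c * 0 + g (z (ω i))) = g (z (ω i)) := by ring
        rw [e]; linarith)
    exact ⟨δ, hδ, fun x h1 h2 => by have := h x h1 h2; linarith⟩
  · intro i
    exact ⟨(hχ _).2, hmaxpt _ (hχ i).1 (hχ i).2 _ ((hlace i).1.trans (hlace i).2)⟩
  · intro i
    exact ⟨hminpt _ (hω i).1 (hω i).2 _ ((hlace i).2.trans (hlace (i + 1)).1), (hω _).2⟩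

lemma h_H (a b d ζ : ℝ) (hζ : ζ ≠ 0) :
    HasDerivAt (fun ζ : ℝ => a * ζ + b / ζ ^ 2 + d / ζ) (a - 2 * b / ζ ^ 3 - d / ζ ^ 2) ζ := by
  have h1 : HasDerivAt (fun ζ : ℝ => a * ζ) a ζ := by
    simpa using (hasDerivAt_id ζ).const_mul a
  have h2 : HasDerivAt (fun ζ : ℝ => b / ζ ^ 2) (-2 * b / ζ ^ 3) ζ := by
    refine ((hasDerivAt_const ζ b).fun_div (hasDerivAt_pow 2 ζ) (pow_ne_zero 2 hζ)).congr_deriv ?_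
    simp only [Nat.cast_ofNat]
    field_simp
    ring
  have h3 : HasDerivAt (fun ζ : ℝ => d / ζ) (-d / ζ ^ 2) ζ := by
    refine ((hasDerivAt_const ζ d).fun_div (hasDerivAt_id ζ) hζ).congr_deriv ?_
    simp
  refine ((h1.fun_add h2).fun_add h3).congr_deriv ?_
  ring

lemma h_Hexp (a b d x : ℝ) :
    HasDerivAt (fun x : ℝ => a * Real.exp x + b / Real.exp x ^ 2 + d / Real.exp x)
      (a * Real.exp x - 2 * b / Real.exp x ^ 2 - d / Real.exp x) x := by
  have h := (h_H a b d (Real.exp x) (Real.exp_pos x).ne').comp x (Real.hasDerivAt_exp x)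
  refine h.congr_deriv ?_
  have := (Real.exp_pos x).ne'
  field_simp

/-- Oscillatory (dispersion-dominated) regime `c² < (4/3)K₁²F'(ζ_r)ζ_r`: a
heteroclinic solution `z` stays above `z_l`, attains its supremum at a unique
point `χ₀` (being strictly increasing before `χ₀`, with a unique inflection
point `ξ₀ < χ₀` there), and has infinitely many strict local maxima `χ_i` and
minima `ω_{i+1}` interlacing as `χ_i < ω_{i+1} < χ_{i+1}`, accumulating at `+∞`,
with `z_r < z(χ_{i+1}) < z(χ_i)` and `z(ω_{i+1}) < z(ω_{i+2}) < z_r`.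
(Here `ω i` denotes `ω_{i+1}` of the paper.) -/
theorem stmt_13 (ζl wl s c : ℝ) (hζl : 0 < ζl)
    (hlax : s > wl / ζl + Real.sqrt ζl) (hc : 0 < c)
    (K1 K2 : ℝ) (hK1 : K1 = wl - s * ζl)
    (hK2 : K2 = -s * wl + ζl ^ 2 / 2 + wl ^ 2 / ζl)
    (F : ℝ → ℝ) (hF : ∀ ζ, F ζ = ζ / 2 + K1 ^ 2 / ζ ^ 2 - (K2 - s * K1) / ζ)
    (ζr : ℝ) (hζr : ζr = -ζl / 2 + (1 / 2) * Real.sqrt ((8 * K1 ^ 2 + ζl ^ 3) / ζl))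
    (zl zr : ℝ) (hzl : zl = Real.log ζl) (hzr : zr = Real.log ζr)
    (hosc : c ^ 2 < (4 / 3) * K1 ^ 2 * deriv F ζr * ζr)
    (z : ℝ → ℝ) (hz : ContDiff ℝ 2 z)
    (hnc : ∃ a b, z a ≠ z b)
    (hode : ∀ ξ, (K1 ^ 2 / 3) * deriv (deriv z) ξ + c * deriv z ξ
      + F (Real.exp (z ξ)) = 0)
    (hlim1 : Filter.Tendsto z Filter.atBot (nhds zl))
    (hlim2 : Filter.Tendsto z Filter.atTop (nhds zr))
    (hlim3 : Filter.Tendsto (deriv z) Filter.atBot (nhds 0))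
    (hlim4 : Filter.Tendsto (deriv z) Filter.atTop (nhds 0)) :
    (∀ ξ, zl < z ξ) ∧
    ∃ χ ω : ℕ → ℝ,
      -- (a) the supremum is attained exactly at χ₀, and z increases before χ₀
      (∀ ξ, z ξ ≤ z (χ 0)) ∧
      (∀ ξ, ξ ≠ χ 0 → z ξ < z (χ 0)) ∧
      (∀ ξ, ξ < χ 0 → 0 < deriv z ξ) ∧
      -- (b) unique inflection point before χ₀
      (∃ ξ₀, ξ₀ < χ 0 ∧
        ∀ ξ, ξ < χ 0 → ξ ≠ ξ₀ → (ξ - ξ₀) * deriv (deriv z) ξ < 0) ∧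
      -- (c) interlaced infinite sequences of strict local maxima and minima
      (∀ i, χ i < ω i ∧ ω i < χ (i + 1)) ∧
      (∀ i, ∃ δ > (0:ℝ), ∀ x, x ≠ χ i → |x - χ i| < δ → z x < z (χ i)) ∧
      (∀ i, ∃ δ > (0:ℝ), ∀ x, x ≠ ω i → |x - ω i| < δ → z (ω i) < z x) ∧
      Filter.Tendsto χ Filter.atTop Filter.atTop ∧
      Filter.Tendsto ω Filter.atTop Filter.atTop ∧
      (∀ i, zr < z (χ (i + 1)) ∧ z (χ (i + 1)) < z (χ i)) ∧
      (∀ i, z (ω i) < z (ω (i + 1)) ∧ z (ω (i + 1)) < zr) := by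
  have hsq : Real.sqrt ζl ^ 2 = ζl := Real.sq_sqrt hζl.le
  have hsq0 : 0 < Real.sqrt ζl := Real.sqrt_pos.2 hζl
  have hK1neg : ζl * Real.sqrt ζl < -K1 := by
    have h1 : wl / ζl < s - Real.sqrt ζl := by linarith
    rw [div_lt_iff₀ hζl] at h1
    rw [hK1]; linarith
  have hK1sq : ζl ^ 3 < K1 ^ 2 := by
    have h0 : 0 < ζl * Real.sqrt ζl := by positivity
    have h1 : (ζl * Real.sqrt ζl) ^ 2 < (-K1) ^ 2 := pow_lt_pow_left₀ hK1neg h0.le two_ne_zero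
    have h2 : (ζl * Real.sqrt ζl) ^ 2 = ζl ^ 3 := by rw [mul_pow, hsq]; ring
    rw [h2] at h1; linarith
  have hK1pos : 0 < K1 ^ 2 := lt_trans (by positivity) hK1sq
  have hR : Real.sqrt ((8 * K1 ^ 2 + ζl ^ 3) / ζl) = 2 * ζr + ζl := by rw [hζr]; ring
  have hRsq : (2 * ζr + ζl) ^ 2 * ζl = 8 * K1 ^ 2 + ζl ^ 3 := by
    rw [← hR, Real.sq_sqrt (by positivity)]; field_simp
  have hR0 : 0 ≤ 2 * ζr + ζl := hR ▸ Real.sqrt_nonneg _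
  have hlr : ζl < ζr := by
    have h1 : (3 * ζl) ^ 2 < (2 * ζr + ζl) ^ 2 := by
      by_contra hcon; push Not at hcon
      have := mul_le_mul_of_nonneg_right hcon hζl.le
      nlinarith
    have := lt_of_pow_lt_pow_left₀ 2 hR0 h1
    linarith
  have hζr0 : 0 < ζr := hζl.trans hlr
  have hKK : K1 ^ 2 = ζl * ζr * (ζl + ζr) / 2 := by nlinarith
  obtain ⟨A, hA⟩ : ∃ A, A = K2 - s * K1 := ⟨_, rfl⟩
  have hA1 : A = (ζl ^ 2 + ζr ^ 2 + ζl * ζr) / 2 := by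
    have h1 : A = ζl ^ 2 / 2 + K1 ^ 2 / ζl := by
      rw [hA, hK2, hK1]; field_simp; ring
    rw [h1, hKK]; field_simp; ring
  have hA0 : 0 < A := by rw [hA1]; positivity
  have hFfac : ∀ ζ, 0 < ζ → F ζ = (ζ - ζl) * (ζ - ζr) * (ζ + ζl + ζr) / (2 * ζ ^ 2) := by
    intro ζ hζ
    rw [hF, ← hA, hKK, hA1]; field_simp; ring
  have hFeq : F = fun ζ => 1 / 2 * ζ + K1 ^ 2 / ζ ^ 2 + -A / ζ := by
    funext ζ; rw [hF, ← hA]; ring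
  have hdF : deriv F ζr = 1 / 2 - 2 * K1 ^ 2 / ζr ^ 3 - -A / ζr ^ 2 := by
    rw [hFeq]; exact (h_H _ _ _ ζr hζr0.ne').deriv
  have hel : Real.exp zl = ζl := by rw [hzl, Real.exp_log hζl]
  have her : Real.exp zr = ζr := by rw [hzr, Real.exp_log hζr0]
  have hm : 0 < K1 ^ 2 / 3 := by positivity
  have hgdef : ∀ x, F (Real.exp x) = 1 / 2 * Real.exp x + K1 ^ 2 / Real.exp x ^ 2 + -A / Real.exp x :=
    fun x => by rw [hFeq]
  have hosc' : c ^ 2 < 4 * (K1 ^ 2 / 3) *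
      (1 / 2 * Real.exp zr - 2 * K1 ^ 2 / Real.exp zr ^ 2 - -A / Real.exp zr) := by
    rw [her]
    refine hosc.trans_eq ?_
    rw [hdF]; field_simp
  -- the zero of the derivative
  have hgq : ∀ ζ : ℝ, 0 < ζ → 1 / 2 * ζ - 2 * K1 ^ 2 / ζ ^ 2 - -A / ζ
      = (ζ ^ 3 / 2 - 2 * K1 ^ 2 + A * ζ) / ζ ^ 2 := by
    intro ζ hζ; field_simp; ring
  have hqmono : ∀ x y : ℝ, 0 < x → x < y → x ^ 3 / 2 - 2 * K1 ^ 2 + A * x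
      < y ^ 3 / 2 - 2 * K1 ^ 2 + A * y := by
    intro x y hx hxy
    have h1 : x ^ 3 < y ^ 3 := pow_lt_pow_left₀ hxy hx.le (by norm_num)
    have h2 := mul_lt_mul_of_pos_left hxy hA0
    linarith
  have hqr : 0 < ζr ^ 3 / 2 - 2 * K1 ^ 2 + A * ζr := by
    rw [her, hgq ζr hζr0] at hosc'
    by_contra hcon; push Not at hcon
    have h1 := div_nonpos_of_nonpos_of_nonneg hcon (sq_nonneg ζr)
    have h2 := mul_nonpos_of_nonneg_of_nonpos (by positivity : 0 ≤ 4 * (K1 ^ 2 / 3)) h1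
    have := sq_nonneg c
    linarith
  obtain ⟨ζs, hζs, hqs⟩ := intermediate_value_Icc (f := fun x : ℝ => x ^ 3 / 2 - 2 * K1 ^ 2 + A * x)
    hζr0.le (by fun_prop) (show (0:ℝ) ∈ Icc _ _ from ⟨by simp; nlinarith, hqr.le⟩)
  simp only at hqs
  have hζs0 : 0 < ζs := by
    refine lt_of_le_of_ne hζs.1 ?_
    rintro rfl
    norm_num at hqs
    rw [hqs] at hK1pos; norm_num at hK1pos
  have hdz : Differentiable ℝ z := hz.differentiable (by norm_num)
  have hdv : Differentiable ℝ (deriv z) := by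
    have : ContDiff ℝ 1 (deriv z) := by
      have h2 : ContDiff ℝ (1 + 1) z := by
        have : (1 + 1 : WithTop ℕ∞) = 2 := by norm_num
        rw [this]; exact hz
      exact (contDiff_succ_iff_deriv.1 h2).2.2
    exact this.differentiable (by norm_num)
  have hdd : ∀ t, deriv (deriv z) t = -(c * deriv z t + (1 / 2 * Real.exp (z t)
      + K1 ^ 2 / Real.exp (z t) ^ 2 + -A / Real.exp (z t))) / (K1 ^ 2 / 3) := by
    intro t
    rw [eq_div_iff hm.ne', ← hgdef]
    linarith [hode t]
  have hmain := h_main (zl := zl) (zr := zr) (zs := Real.log ζs) (c := c) (z := z) (v := deriv z)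
    (G := fun x => 1 / 2 * Real.exp x + (-(K1 ^ 2) / 2) / Real.exp x ^ 2 + A / Real.exp x)
    (g := fun x => 1 / 2 * Real.exp x + K1 ^ 2 / Real.exp x ^ 2 + -A / Real.exp x)
    (g' := fun x => 1 / 2 * Real.exp x - 2 * K1 ^ 2 / Real.exp x ^ 2 - -A / Real.exp x)
    hm hc (fun x => (h_Hexp _ _ _ x).congr_deriv (by ring)) (fun x => h_Hexp _ _ _ x)
    (by rw [hzl, hzr]; exact Real.log_lt_log hζl hlr)
    (by simp only [← hgdef]; rw [hel, hFfac _ hζl]; simp)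
    (by simp only [← hgdef]; rw [her, hFfac _ hζr0]; simp)
    (by
      intro x h1 h2
      simp only [← hgdef]; rw [hFfac _ (Real.exp_pos x)]
      have h3 : ζl < Real.exp x := hel ▸ Real.exp_lt_exp.2 h1
      have h4 : Real.exp x < ζr := her ▸ Real.exp_lt_exp.2 h2
      refine div_neg_of_neg_of_pos (mul_neg_of_neg_of_pos (mul_neg_of_pos_of_neg ?_ ?_) ?_)
        (by positivity) <;> linarith)
    (by
      intro x h2
      simp only [← hgdef]; rw [hFfac _ (Real.exp_pos x)]
      have h4 : ζr < Real.exp x := her ▸ Real.exp_lt_exp.2 h2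
      refine div_pos (mul_pos (mul_pos ?_ ?_) ?_) (by positivity) <;> linarith)
    (by
      intro x hx
      rw [hgq _ (Real.exp_pos x)]
      have h1 : Real.exp x < ζs := (Real.lt_log_iff_exp_lt hζs0).1 hx
      exact div_neg_of_neg_of_pos (by linarith [hqmono _ _ (Real.exp_pos x) h1]) (by positivity))
    (by
      intro x hx
      rw [hgq _ (Real.exp_pos x)]
      have h1 : ζs < Real.exp x := (Real.log_lt_iff_lt_exp hζs0).1 hx
      exact div_pos (by linarith [hqmono _ _ hζs0 h1]) (by positivity))
    hosc' (fun t => (hdz t).hasDerivAt) (fun t => (hdv t).hasDerivAt.congr_deriv (hdd t))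
    hlim1 hlim2 hlim3
  simp only [hdd]
  exact hmain
end

section
/- Let c > 0 and let (z,v) : ℝ → ℝ² be a continuously differentiable solution of the system z' = v, v' = −(3/K₁²)·F(e^z) − (3c/K₁²)·v such that z(ξ) → ln ζ_l and v(ξ) → 0 as ξ → −∞, and ln ζ_l < z(ξ) < ln ζ̄ for all ξ ∈ ℝ. Then for all ξ ∈ ℝ one has the bounds −2·F(ζ̄)/c < v(ξ) < −2·F(ζ_c)/c, where ζ_c is the unique positive zero of F'. -/
open Filter Topology in
lemma gron (a A : ℝ) (ha : 0 < a) (v : ℝ → ℝ) (hv : Differentiable ℝ v)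
    (h : ∀ x, deriv v x ≤ a * (A - v x)) (hl : Tendsto v atBot (𝓝 0)) (x : ℝ) : v x ≤ A := by
  have hd : ∀ x, HasDerivAt (fun x => Real.exp (a * x) * (v x - A))
      (Real.exp (a * x) * (a * 1) * (v x - A) + Real.exp (a * x) * deriv v x) x := by
    intro x
    exact (((hasDerivAt_id x).const_mul a).exp).mul ((hv x).hasDerivAt.sub_const A)
  have hanti : Antitone (fun x => Real.exp (a * x) * (v x - A)) := by
    apply antitone_of_deriv_nonpos (fun x => (hd x).differentiableAt)
    intro x
    rw [(hd x).deriv]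
    have := mul_le_mul_of_nonneg_left (h x) (Real.exp_pos (a * x)).le
    nlinarith
  have hlim : Tendsto (fun x => Real.exp (a * x) * (v x - A)) atBot (𝓝 (0 * (0 - A))) := by
    apply Tendsto.mul
    · exact Real.tendsto_exp_atBot.comp (tendsto_id.const_mul_atBot ha)
    · exact hl.sub_const A
  have h1 : Real.exp (a * x) * (v x - A) ≤ 0 * (0 - A) :=
    ge_of_tendsto hlim ((eventually_le_atBot x).mono fun y hy => hanti hy)
  have := Real.exp_pos (a * x)
  by_contra hcon
  push Not at hcon
  nlinarith [mul_pos this (sub_pos.2 hcon)]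


/-- A solution of the first order system emanating from `(ln ζ_l, 0)` at `−∞` and
confined to `ln ζ_l < z < ln ζ̄` satisfies `−2F(ζ̄)/c < v(ξ) < −2F(ζ_c)/c`. -/
theorem stmt_14 (ζl wl s c : ℝ) (hζl : 0 < ζl)
    (hlax : s > wl / ζl + Real.sqrt ζl) (hc : 0 < c)
    (K1 K2 : ℝ) (hK1 : K1 = wl - s * ζl)
    (hK2 : K2 = -s * wl + ζl ^ 2 / 2 + wl ^ 2 / ζl)
    (F : ℝ → ℝ) (hF : ∀ ζ, F ζ = ζ / 2 + K1 ^ 2 / ζ ^ 2 - (K2 - s * K1) / ζ)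
    (ζr : ℝ) (hζr : ζr = -ζl / 2 + (1 / 2) * Real.sqrt ((8 * K1 ^ 2 + ζl ^ 3) / ζl))
    (ζb : ℝ) (hζb : ζb = K1 ^ 2 / ζl ^ 2)
    (ζc : ℝ) (hζc : 0 < ζc ∧ deriv F ζc = 0 ∧
      ∀ ζ', 0 < ζ' → deriv F ζ' = 0 → ζ' = ζc)
    (z v : ℝ → ℝ) (hz : ContDiff ℝ 1 z) (hv : ContDiff ℝ 1 v)
    (hsys1 : ∀ ξ, deriv z ξ = v ξ)
    (hsys2 : ∀ ξ, deriv v ξ = -(3 / K1 ^ 2) * F (Real.exp (z ξ))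
      - (3 * c / K1 ^ 2) * v ξ)
    (hlimz : Filter.Tendsto z Filter.atBot (nhds (Real.log ζl)))
    (hlimv : Filter.Tendsto v Filter.atBot (nhds 0))
    (hbound : ∀ ξ, Real.log ζl < z ξ ∧ z ξ < Real.log ζb) :
    ∀ ξ : ℝ, -2 * F ζb / c < v ξ ∧ v ξ < -2 * F ζc / c := by
  have hsq := Real.sq_sqrt hζl.le
  have hsp := Real.sqrt_pos.2 hζl
  have hK1neg : ζl * Real.sqrt ζl < -K1 := by
    have h1 : ζl * (wl / ζl + Real.sqrt ζl) < ζl * s := mul_lt_mul_of_pos_left hlax hζl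
    have h2 : ζl * (wl / ζl) = wl := by field_simp
    nlinarith
  have hk : ζl ^ 3 < K1 ^ 2 := by
    have h1 : 0 < ζl * Real.sqrt ζl := by positivity
    have h2 : (ζl * Real.sqrt ζl) ^ 2 < (-K1) ^ 2 := pow_lt_pow_left₀ hK1neg h1.le (by norm_num)
    have h3 : (ζl * Real.sqrt ζl) ^ 2 = ζl ^ 3 := by rw [mul_pow, hsq]; ring
    nlinarith
  have hM : K2 - s * K1 = ζl ^ 2 / 2 + K1 ^ 2 / ζl := by
    rw [hK2, hK1]; field_simp; ring
  rw [hM] at hF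
  clear hK1neg hM hlax hK2 hK1 hζr
  generalize hkk : K1 ^ 2 = k at *
  have hk0 : 0 < k := lt_trans (by positivity) hk
  have hb : ζl < ζb := by
    rw [hζb, lt_div_iff₀ (by positivity)]; nlinarith
  have hb0 : 0 < ζb := hζl.trans hb
  have hkb : k = ζb * ζl ^ 2 := by rw [hζb]; field_simp
  have hFl : F ζl = 0 := by rw [hF]; field_simp; ring
  have hFb : F ζb = (ζb - ζl) ^ 2 / (2 * ζb) := by rw [hF, hkb]; field_simp; ring
  have hFbpos : 0 < F ζb := by
    rw [hFb]; have := sub_pos.2 hb; positivity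
  have hder : ∀ x, 0 < x → deriv F x = 1 / 2 - 2 * k / x ^ 3 + (ζl ^ 2 / 2 + k / ζl) / x ^ 2 := by
    intro x hx
    have hFe : F = fun ζ => ζ / 2 + k / ζ ^ 2 - (ζl ^ 2 / 2 + k / ζl) / ζ := funext hF
    rw [hFe]
    have h1 := (((hasDerivAt_id x).div_const 2).add
      ((hasDerivAt_const x k).div (hasDerivAt_pow 2 x) (by positivity))).sub
      ((hasDerivAt_const x (ζl ^ 2 / 2 + k / ζl)).div (hasDerivAt_id x) hx.ne')
    refine (h1.deriv).trans ?_
    simp only [id]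
    field_simp
    ring
  obtain ⟨hc0, hcd, -⟩ := hζc
  have hne : ζl ≠ ζc := by
    rintro rfl
    rw [hder _ hζl] at hcd
    field_simp at hcd
    nlinarith
  rw [hder _ hc0] at hcd
  have hdiff : ∀ x, 0 < x → F x - F ζc = (1 / x - 1 / ζc) ^ 2 * (x * ζc ^ 2 / 2 + k) := by
    intro x hx
    have hMe : ζl ^ 2 / 2 + k / ζl = 2 * k / ζc - ζc ^ 2 / 2 := by
      generalize ζl ^ 2 / 2 + k / ζl = M at *
      field_simp at hcd ⊢
      linarith
    rw [hF, hF, hMe]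
    field_simp
    ring
  have hmin : ∀ x, 0 < x → F ζc ≤ F x := by
    intro x hx
    have := hdiff x hx
    have h2 : 0 ≤ (1 / x - 1 / ζc) ^ 2 * (x * ζc ^ 2 / 2 + k) := by positivity
    linarith
  have hFc : F ζc < 0 := by
    have := hdiff ζl hζl
    have h3 : 1 / ζl - 1 / ζc ≠ 0 := by
      intro h
      apply hne
      field_simp at h
      linarith
    have h2 : 0 < (1 / ζl - 1 / ζc) ^ 2 * (ζl * ζc ^ 2 / 2 + k) := by positivity
    linarith
  have hmax : ∀ x, ζl < x → x < ζb → F x ≤ F ζb := by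
    intro x hx1 hx2
    have hx : 0 < x := hζl.trans hx1
    have e : F x = (x - ζl) * (1 + ζl / x - 2 * ζb * ζl / x ^ 2) / 2 := by
      rw [hF, hkb]; field_simp; ring
    have e2 : F ζb = (ζb - ζl) * (1 - ζl / ζb) / 2 := by
      rw [hFb]; field_simp
    have g : 1 + ζl / x - 2 * ζb * ζl / x ^ 2 ≤ 1 - ζl / ζb := by
      have : (1 - ζl / ζb) - (1 + ζl / x - 2 * ζb * ζl / x ^ 2)
          = ζl * (ζb - x) * (2 * ζb + x) / (ζb * x ^ 2) := by
        field_simp <;> ring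
      have h2 : 0 ≤ ζl * (ζb - x) * (2 * ζb + x) / (ζb * x ^ 2) := by
        have := sub_pos.2 hx2
        positivity
      linarith
    have g2 : 0 < 1 - ζl / ζb := by
      rw [sub_pos, div_lt_one hb0]; exact hb
    rw [e, e2]
    nlinarith [mul_le_mul_of_nonneg_left g (sub_pos.2 hx1).le,
      mul_le_mul_of_nonneg_right hx2.le g2.le]
  have hrange : ∀ ξ, ζl < Real.exp (z ξ) ∧ Real.exp (z ξ) < ζb := fun ξ =>
    ⟨(Real.log_lt_iff_lt_exp hζl).1 (hbound ξ).1, (Real.lt_log_iff_exp_lt hb0).1 (hbound ξ).2⟩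
  have hvd : Differentiable ℝ v := hv.differentiable (by norm_num)
  have ha : 0 < 3 * c / k := by positivity
  intro ξ
  have up : v ξ ≤ -F ζc / c := by
    apply gron (3 * c / k) _ ha v hvd _ hlimv
    intro x
    rw [hsys2]
    have h1 := hmin _ (Real.exp_pos (z x))
    have h2 : 3 * c / k * (-F ζc / c - v x) = -(3 / k) * F ζc - 3 * c / k * v x := by
      field_simp
    have h3 : 0 < 3 / k := by positivity
    rw [h2]
    nlinarith
  have lo : (fun x => -v x) ξ ≤ F ζb / c := by
    apply gron (3 * c / k) _ ha (fun x => -v x) hvd.neg _ (by simpa using hlimv.neg)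
    intro x
    rw [deriv.fun_neg, hsys2]
    have h1 := hmax _ (hrange x).1 (hrange x).2
    have h2 : 3 * c / k * (F ζb / c - -v x) = (3 / k) * F ζb + 3 * c / k * v x := by
      field_simp <;> ring
    have h3 : 0 < 3 / k := by positivity
    rw [h2]
    nlinarith
  have p1 : 0 < F ζb / c := by positivity
  have p2 : 0 < -F ζc / c := div_pos (by linarith) hc
  have q1 : -2 * F ζb / c = -2 * (F ζb / c) := by ring
  have q2 : -2 * F ζc / c = 2 * (-F ζc / c) := by ring
  rw [q1, q2]
  constructor <;> simp only at lo <;> linarith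
end

section
/- Let h_r > 0, q_r ∈ ℝ and s ∈ ℝ with s > q_r/h_r + √h_r. Define h_l = (−h_r + √(h_r² + 8·h_r·(q_r/h_r − s)²))/2 and q_l = (2·q_r − 3·s·h_r + s·√(h_r² + 8·h_r·(q_r/h_r − s)²))/2. Then h_l > h_r > 0 and the Rankine–Hugoniot conditions hold: s·(h_l − h_r) = q_l − q_r and s·(q_l − q_r) = h_l²/2 − h_r²/2 + q_l²/h_l − q_r²/h_r. -/
/-- Given a right state `(h_r, q_r)` with `h_r > 0` and a speed `s` satisfying the
Lax condition `s > q_r/h_r + √h_r`, the left state defined by the explicit formulas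
satisfies `h_l > h_r > 0` and the Rankine–Hugoniot conditions of the shallow water
system. -/
theorem stmt_15 (hr qr s : ℝ) (hhr : 0 < hr)
    (hlax : s > qr / hr + Real.sqrt hr)
    (hl ql : ℝ)
    (hhl : hl = (-hr + Real.sqrt (hr ^ 2 + 8 * hr * (qr / hr - s) ^ 2)) / 2)
    (hql : ql = (2 * qr - 3 * s * hr
      + s * Real.sqrt (hr ^ 2 + 8 * hr * (qr / hr - s) ^ 2)) / 2) :
    hl > hr ∧ hr > 0 ∧
    s * (hl - hr) = ql - qr ∧
    s * (ql - qr) = hl ^ 2 / 2 - hr ^ 2 / 2 + ql ^ 2 / hl - qr ^ 2 / hr := by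
  obtain ⟨v, hv⟩ : ∃ v, v = qr / hr := ⟨_, rfl⟩
  have hq : qr = v * hr := by rw [hv]; field_simp
  rw [← hv] at hlax hhl hql
  have hs0 := Real.sqrt_nonneg hr
  have hs2 := Real.sq_sqrt hhr.le
  have hw : hr < (v - s) ^ 2 := by nlinarith
  have hR2 : Real.sqrt (hr ^ 2 + 8 * hr * (v - s) ^ 2) ^ 2
      = hr ^ 2 + 8 * hr * (v - s) ^ 2 := Real.sq_sqrt (by positivity)
  have hR : 3 * hr < Real.sqrt (hr ^ 2 + 8 * hr * (v - s) ^ 2) := by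
    apply Real.lt_sqrt_of_sq_lt
    nlinarith [mul_lt_mul_of_pos_left hw hhr]
  generalize Real.sqrt (hr ^ 2 + 8 * hr * (v - s) ^ 2) = R at *
  have hgt : hl > hr := by linarith
  have hlpos : 0 < hl := by linarith
  have hRe : R = 2 * hl + hr := by linarith
  have key : hl ^ 2 + hl * hr = 2 * hr * (v - s) ^ 2 := by
    rw [hRe] at hR2
    linarith
  have hqle : ql = s * hl - (s - v) * hr := by rw [hql, hRe, hq]; ring
  refine ⟨hgt, hhr, by rw [hqle, hq]; ring, ?_⟩
  have e1 : ql ^ 2 / hl = s ^ 2 * hl - 2 * s * (s - v) * hr + hr * (hl + hr) / 2 := by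
    rw [div_eq_iff hlpos.ne', hqle]
    linear_combination (-hr / 2) * key
  have e2 : qr ^ 2 / hr = v ^ 2 * hr := by
    rw [div_eq_iff hhr.ne', hq]; ring
  rw [e1, e2, hqle, hq]
  linear_combination (-1 / 2) * key
end

section
/- There exists a constant C > 0 such that for all A > 0 and B > 0 there exists T > 0 with the following property: every nonnegative differentiable function y : [0,T] → ℝ with y(0) = 0 that satisfies (d/dt)(y(t)²) ≤ A·y(t) + B·y(t)³ for all t ∈ [0,T] obeys the bound y(t) ≤ C·A·t for all t ∈ [0,T]. -/
/-- Gronwall-type lemma: there is `C > 0` such that for all `A, B > 0` there is a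
time `T > 0` so that every nonnegative differentiable function `y` on `[0,T]` with
`y(0) = 0` and `(y²)' ≤ A·y + B·y³` on `[0,T]` satisfies `y(t) ≤ C·A·t`. -/
theorem stmt_17 :
    ∃ C : ℝ, 0 < C ∧ ∀ A B : ℝ, 0 < A → 0 < B →
      ∃ T : ℝ, 0 < T ∧ ∀ y : ℝ → ℝ,
        (∀ t ∈ Set.Icc (0 : ℝ) T, 0 ≤ y t) →
        (∀ t ∈ Set.Icc (0 : ℝ) T, DifferentiableAt ℝ y t) →
        y 0 = 0 →
        (∀ t ∈ Set.Icc (0 : ℝ) T,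
          deriv (fun τ => y τ ^ 2) t ≤ A * y t + B * y t ^ 3) →
        ∀ t ∈ Set.Icc (0 : ℝ) T, y t ≤ C * A * t := by
  refine ⟨1, one_pos, fun A B hA hB => ⟨1 / (2 * (1 + A * B)), by positivity, ?_⟩⟩
  have hAB : 0 < A * B := mul_pos hA hB
  set T : ℝ := 1 / (2 * (1 + A * B)) with hT
  have hTpos : 0 < T := by positivity
  have hT1 : 2 * T * (1 + A * B) = 1 := by rw [hT]; field_simp
  have hT2 : B * (2 * A * T) ^ 2 < A := by
    have h1 : 2 * T * (A * B) < 1 := by nlinarith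
    have h2 : 2 * T < 1 := by nlinarith
    have h3 : (2 * T * (A * B)) * (2 * T) < 1 := by nlinarith [mul_pos hTpos hAB]
    calc B * (2 * A * T) ^ 2 = A * ((2 * T * (A * B)) * (2 * T)) := by ring
      _ < A * 1 := mul_lt_mul_of_pos_left h3 hA
      _ = A := mul_one A
  intro y hy hd h0 hineq t ht
  have key : ∀ ε : ℝ, 0 < ε → ε ≤ A * T → y t ≤ A * t + ε := by
    intro ε hε hεT
    refine image_le_of_deriv_right_lt_deriv_boundary' (f := y) (f' := deriv y)
      (a := 0) (b := T) (B := fun s => A * s + ε) (B' := fun _ => A)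
      (fun x hx => (hd x hx).continuousAt.continuousWithinAt)
      (fun x hx => (hd x ⟨hx.1, hx.2.le⟩).hasDerivAt.hasDerivWithinAt)
      (by simp [h0, hε.le]) (by fun_prop) (fun x _ => ?_) ?_ ht
    · simpa using (((hasDerivAt_id x).const_mul A).add_const ε).hasDerivWithinAt
    · intro x hx hxe
      have hx' : x ∈ Set.Icc (0 : ℝ) T := ⟨hx.1, hx.2.le⟩
      have hi := hineq x hx'
      have hder : deriv (fun τ => y τ ^ 2) x = 2 * y x * deriv y x := by
        simpa using ((hd x hx').hasDerivAt.fun_pow 2).deriv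
      rw [hder] at hi
      have hAx : 0 ≤ A * x := mul_nonneg hA.le hx.1
      have hpos : 0 < y x := by rw [hxe]; positivity
      have hle : y x ≤ 2 * A * T := by
        have := mul_le_mul_of_nonneg_left hx.2.le hA.le
        linarith
      have hsq : B * y x ^ 2 < A :=
        lt_of_le_of_lt (by gcongr) hT2
      have h5 : y x * (2 * deriv y x) ≤ y x * (A + B * y x ^ 2) := by linarith
      have h6 := le_of_mul_le_mul_left h5 hpos
      linarith
  rw [one_mul]
  refine le_of_forall_pos_le_add fun ε hε => ?_
  have h := key (min ε (A * T)) (lt_min hε (by positivity)) (min_le_right _ _)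
  linarith [min_le_left ε (A * T)]
end
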